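/- If a finite simple graph G contains a subdivision of K₄ as a subgraph, then at least one of the following holds: G has a proper K₄-subdivision; G is a k-wheel for some positive integer k; or G is a subdivision of one of the graphs K₄, K_{3,3}, or the prism. -/

import Mathlib

open SimpleGraph

namespace IMWQO

/-- `H` is an induced minor of `G`: there is a family of pairwise disjoint nonempty
connected subsets of `V(G)`, indexed by `V(H)`, such that distinct branch sets are
joined by an edge of `G` iff the corresponding vertices are adjacent in `H`. -/
def IsInducedMinor {α β : Type*} (H : SimpleGraph α) (G : SimpleGraph β) : Prop :=
  ∃ μ : α → Set β,
    (∀ a, (μ a).Nonempty) ∧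
    (∀ a b, a ≠ b → Disjoint (μ a) (μ b)) ∧
    (∀ a, (G.induce (μ a)).Connected) ∧
    (∀ a b, a ≠ b → ((∃ x ∈ μ a, ∃ y ∈ μ b, G.Adj x y) ↔ H.Adj a b))

/-- A bundled finite simple graph. -/
abbrev FinGraph := Σ n : ℕ, SimpleGraph (Fin n)

/-- The induced minor relation on bundled finite graphs. -/
def FinGraph.IM (H G : FinGraph) : Prop := IsInducedMinor H.2 G.2

/-- A class of finite graphs is well-quasi-ordered by the induced minor relation. -/
def WqoClass (P : FinGraph → Prop) : Prop :=
  ∀ f : ℕ → FinGraph, (∀ i, P (f i)) → ∃ i j, i < j ∧ FinGraph.IM (f i) (f j)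

/-- `K̂₄`: `K₄` (on vertices `0,1,2,3`) plus a vertex `4` adjacent to `0` and `1`. -/
def hatK4 : SimpleGraph (Fin 5) :=
  SimpleGraph.fromRel fun a b =>
    (a.val < 4 ∧ b.val < 4) ∨ (a.val = 4 ∧ (b.val = 0 ∨ b.val = 1))

/-- The gem: the path `0 - 1 - 2 - 3` plus a dominating vertex `4`. -/
def gem : SimpleGraph (Fin 5) :=
  SimpleGraph.fromRel fun a b =>
    (b.val = a.val + 1 ∧ b.val ≤ 3) ∨ a.val = 4

/-- The complete graph on four vertices. -/
def K4 : SimpleGraph (Fin 4) := ⊤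

/-- The prism, i.e. the Cartesian (box) product `K₃ □ K₂`. -/
def prism : SimpleGraph (Fin 3 × Fin 2) :=
  (⊤ : SimpleGraph (Fin 3)) □ (⊤ : SimpleGraph (Fin 2))

/-- The complete bipartite graph `K_{3,3}`. -/
def K33 : SimpleGraph (Fin 3 ⊕ Fin 3) := completeBipartiteGraph (Fin 3) (Fin 3)

/-- Subdivide the edge `{u,v}` of `G`, the new vertex being `Fin.last n`. -/
def subdivideEdge {n : ℕ} (G : SimpleGraph (Fin n)) (u v : Fin n) :
    SimpleGraph (Fin (n + 1)) :=
  SimpleGraph.fromRel fun a b =>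
    (∃ a' b' : Fin n, a = a'.castSucc ∧ b = b'.castSucc ∧ G.Adj a' b' ∧
      ¬(a' = u ∧ b' = v) ∧ ¬(a' = v ∧ b' = u))
    ∨ (a = Fin.last n ∧ (b = u.castSucc ∨ b = v.castSucc))

/-- One subdivision step on bundled graphs: the first graph is obtained from the
second one by subdividing one edge. -/
inductive SubdivStep : FinGraph → FinGraph → Prop
  | mk {n : ℕ} (G : SimpleGraph (Fin n)) (u v : Fin n) (h : G.Adj u v) :
      SubdivStep ⟨n + 1, subdivideEdge G u v⟩ ⟨n, G⟩

/-- `G` is (isomorphic to) a subdivision of `H`. -/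
def IsSubdivision {α β : Type*} (G : SimpleGraph α) (H : SimpleGraph β) : Prop :=
  ∃ A B : FinGraph, Nonempty (G ≃g A.2) ∧ Nonempty (H ≃g B.2) ∧
    Relation.ReflTransGen SubdivStep A B

/-- `G` contains a subdivision of `H` as a subgraph. -/
def ContainsSubdivAsSubgraph {α β : Type*} (G : SimpleGraph α) (H : SimpleGraph β) : Prop :=
  ∃ S : G.Subgraph, IsSubdivision S.coe H

/-- `G` has a proper `K₄`-subdivision: for some vertex `v`, `G - v` contains
a subdivision of `K₄` as a subgraph. -/
def HasProperK4Subdivision {α : Type*} (G : SimpleGraph α) : Prop :=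
  ∃ v : α, ContainsSubdivAsSubgraph (G.induce {u | u ≠ v}) K4

/-- `G` is 2-connected: at least 3 vertices, and removing any vertex leaves it connected. -/
def TwoConnected {α : Type*} [Fintype α] (G : SimpleGraph α) : Prop :=
  3 ≤ Fintype.card α ∧ ∀ v : α, (G.induce {u | u ≠ v}).Connected

/-- `G` is complete multipartite: two vertices are adjacent iff they lie in different
classes of some partition (equivalence relation). -/
def IsCompleteMultipartite {α : Type*} (G : SimpleGraph α) : Prop :=
  ∃ s : Setoid α, ∀ u v, G.Adj u v ↔ ¬ s.r u v

/-- `G` is a cograph: it has no induced path on four vertices. -/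
def IsCograph {α : Type*} (G : SimpleGraph α) : Prop :=
  ∀ f : Fin 4 → α, Function.Injective f →
    ¬ (∀ a b : Fin 4, G.Adj (f a) (f b) ↔ (pathGraph 4).Adj a b)

/-- `G` is a linear forest: acyclic with maximum degree at most 2,
i.e. a disjoint union of paths. -/
def IsLinearForest {α : Type*} (G : SimpleGraph α) : Prop :=
  G.IsAcyclic ∧ ∀ v, (G.neighborSet v).ncard ≤ 2

/-- The set `C` induces an (induced) cycle in `G`. -/
def InducesCycle {α : Type*} (G : SimpleGraph α) (C : Set α) : Prop :=
  ∃ n : ℕ, 3 ≤ n ∧ Nonempty ((G.induce C) ≃g cycleGraph n)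

/-- The set `S` induces a path in `G` all of whose internal vertices have degree two
in `G`. -/
def IsBasicPath {α : Type*} (G : SimpleGraph α) (S : Set α) : Prop :=
  ∃ (n : ℕ) (φ : (G.induce S) ≃g pathGraph n),
    ∀ v : S, (φ v).val ≠ 0 → (φ v).val ≠ n - 1 → (G.neighborSet v.val).ncard = 2

/-- The wheel with cycle `0, …, n-1` and center adjacent to the vertices of `T`. -/
def wheelGraph (n : ℕ) (T : Finset (Fin n)) : SimpleGraph (Fin n ⊕ Unit) :=
  SimpleGraph.fromRel fun a b =>
    (∃ x y : Fin n, a = Sum.inl x ∧ b = Sum.inl y ∧ (cycleGraph n).Adj x y)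
    ∨ (∃ x ∈ T, a = Sum.inr () ∧ b = Sum.inl x)

/-- `G` is a `k`-wheel: a cycle of order at least `max k 3` plus a center adjacent to
exactly `k` distinct vertices of the cycle. -/
def IsWheel {α : Type*} (k : ℕ) (G : SimpleGraph α) : Prop :=
  ∃ n : ℕ, 3 ≤ n ∧ k ≤ n ∧ ∃ T : Finset (Fin n), T.card = k ∧
    Nonempty (G ≃g wheelGraph n T)

/-- A 3-wheel subgraph of `G`: a cycle of `G` together with a center outside the cycle
joined to (at least) three distinct vertices of the cycle by edges of `G`. -/
structure ThreeWheelSub {α : Type*} (G : SimpleGraph α) where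
  base : α
  cyc : G.Walk base base
  cyc_isCycle : cyc.IsCycle
  center : α
  center_not_mem : center ∉ cyc.support
  spokes : Finset α
  spokes_card : spokes.card = 3
  spokes_sub : ∀ x ∈ spokes, x ∈ cyc.support
  spokes_adj : ∀ x ∈ spokes, G.Adj center x

/-- The number of vertices of a 3-wheel subgraph. -/
def ThreeWheelSub.order {α : Type*} [DecidableEq α] {G : SimpleGraph α}
    (W : ThreeWheelSub G) : ℕ :=
  W.cyc.support.toFinset.card + 1

/-- `G` has a cycle-multipartite decomposition. -/
def HasCycleMultipartiteDecomp {α : Type*} (G : SimpleGraph α) : Prop :=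
  ∃ C R : Set α, C ∪ R = Set.univ ∧ Disjoint C R ∧
    InducesCycle G C ∧ IsCompleteMultipartite (G.induce R) ∧
    ∀ u ∈ R, ∀ v ∈ R, ∀ c ∈ C, (G.Adj u c ↔ G.Adj v c)

/-- A bundled finite simple graph whose vertices are labeled by finite subsets of `S`. -/
structure LabGraph (S : Type*) where
  n : ℕ
  graph : SimpleGraph (Fin n)
  label : Fin n → Finset S

/-- The domination order on finite subsets of a quasi-order: `A ≤^P B` iff there is an
injection `φ : A → B` with `r a (φ a)` for all `a ∈ A`. -/
def FinsetLE {S : Type*} (r : S → S → Prop) (A B : Finset S) : Prop :=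
  ∃ φ : {x // x ∈ A} → {x // x ∈ B}, Function.Injective φ ∧ ∀ a, r a.val (φ a).val

/-- The union of the labels of the vertices in `A`. -/
noncomputable def labelUnion {S : Type*} {n : ℕ} (lab : Fin n → Finset S)
    (A : Finset (Fin n)) : Finset S :=
  letI := Classical.decEq S
  A.biUnion lab

/-- Label-respecting induced minor relation on labeled graphs. -/
def LabIM {S : Type*} (r : S → S → Prop) (H G : LabGraph S) : Prop :=
  ∃ μ : Fin H.n → Finset (Fin G.n),
    (∀ a, (μ a).Nonempty) ∧
    (∀ a b, a ≠ b → Disjoint (μ a) (μ b)) ∧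
    (∀ a, (G.graph.induce (↑(μ a) : Set (Fin G.n))).Connected) ∧
    (∀ a b, a ≠ b → ((∃ x ∈ μ a, ∃ y ∈ μ b, G.graph.Adj x y) ↔ H.graph.Adj a b)) ∧
    (∀ a, FinsetLE r (H.label a) (labelUnion G.label (μ a)))

/-- Label-respecting contraction relation on labeled graphs: an induced minor model
whose branch sets cover all vertices. -/
def LabContraction {S : Type*} (r : S → S → Prop) (H G : LabGraph S) : Prop :=
  ∃ μ : Fin H.n → Finset (Fin G.n),
    (∀ a, (μ a).Nonempty) ∧
    (∀ a b, a ≠ b → Disjoint (μ a) (μ b)) ∧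
    (∀ x : Fin G.n, ∃ a, x ∈ μ a) ∧
    (∀ a, (G.graph.induce (↑(μ a) : Set (Fin G.n))).Connected) ∧
    (∀ a b, a ≠ b → ((∃ x ∈ μ a, ∃ y ∈ μ b, G.graph.Adj x y) ↔ H.graph.Adj a b)) ∧
    (∀ a, FinsetLE r (H.label a) (labelUnion G.label (μ a)))

/-- Label-respecting induced subgraph relation on labeled graphs. -/
def LabISub {S : Type*} (r : S → S → Prop) (H G : LabGraph S) : Prop :=
  ∃ φ : Fin H.n → Fin G.n, Function.Injective φ ∧
    (∀ a b, H.graph.Adj a b ↔ G.graph.Adj (φ a) (φ b)) ∧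
    (∀ a, FinsetLE r (H.label a) (G.label (φ a)))

/-- A relation is a well-quasi-order: every infinite sequence contains a good pair. -/
def IsWqo {S : Type*} (r : S → S → Prop) : Prop :=
  ∀ g : ℕ → S, ∃ i j, i < j ∧ r (g i) (g j)

/-- `x` and `y` are joined by a walk of `G` that stays inside `S`. -/
def ConnIn {α : Type*} (G : SimpleGraph α) (S : Set α) : α → α → Prop :=
  Relation.ReflTransGen fun x y => G.Adj x y ∧ x ∈ S ∧ y ∈ S

namespace ConnIn

variable {α : Type*} {G : SimpleGraph α} {S T : Set α} {x y z : α}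

theorem refl : ConnIn G S x x := Relation.ReflTransGen.refl

theorem of_adj (h : G.Adj x y) (hx : x ∈ S) (hy : y ∈ S) : ConnIn G S x y :=
  Relation.ReflTransGen.single ⟨h, hx, hy⟩

theorem trans (h : ConnIn G S x y) (h' : ConnIn G S y z) : ConnIn G S x z :=
  Relation.ReflTransGen.trans h h'

theorem symm (h : ConnIn G S x y) : ConnIn G S y x := by
  induction h with
  | refl => exact refl
  | tail _ h ih => exact (of_adj h.1.symm h.2.2 h.2.1).trans ih

/-- A map sending each edge inside `S` to a connected pair inside `T` preserves connection. -/
theorem lift {α' : Type*} {G' : SimpleGraph α'} {T : Set α'} (f : α → α')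
    (hf : ∀ a b, G.Adj a b → a ∈ S → b ∈ S → ConnIn G' T (f a) (f b))
    (h : ConnIn G S x y) : ConnIn G' T (f x) (f y) :=
  Relation.ReflTransGen.lift' f (fun a b hab => hf a b hab.1 hab.2.1 hab.2.2) _ _ h

theorem mono (hST : S ⊆ T) (h : ConnIn G S x y) : ConnIn G T x y :=
  lift id (fun _ _ hab ha hb => of_adj hab (hST ha) (hST hb)) h

/-- Connections inside `S` survive passing to a graph on a subtype containing `S`. -/
theorem subtype {P : α → Prop} {G' : SimpleGraph {x // P x}} (hS : ∀ x ∈ S, P x)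
    (hG' : ∀ x y (hx : x ∈ S) (hy : y ∈ S), G.Adj x y → G'.Adj ⟨x, hS x hx⟩ ⟨y, hS y hy⟩)
    (hx : P x) (hy : P y) (h : ConnIn G S x y) :
    ConnIn G' (Subtype.val ⁻¹' S) ⟨x, hx⟩ ⟨y, hy⟩ := by
  classical
  have := h.lift (G' := G') (T := Subtype.val ⁻¹' S)
    (fun z => if h : P z then ⟨z, h⟩ else ⟨x, hx⟩) (by
      intro u v huv hu hv
      simp only [dif_pos (hS u hu), dif_pos (hS v hv)]
      exact .of_adj (hG' u v hu hv huv) hu hv)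
  simpa only [dif_pos hx, dif_pos hy] using this

theorem of_walk (p : G.Walk x y) (hp : ∀ z ∈ p.support, z ∈ S) : ConnIn G S x y := by
  induction p with
  | nil => exact refl
  | cons h p ih =>
    simp only [Walk.support_cons, List.mem_cons, forall_eq_or_imp] at hp
    exact (of_adj h hp.1 (hp.2 _ p.start_mem_support)).trans (ih hp.2)

theorem exists_isPath (h : ConnIn G S x y) (hx : x ∈ S) :
    ∃ p : G.Walk x y, p.IsPath ∧ ∀ z ∈ p.support, z ∈ S := by
  classical
  suffices H : ∃ p : G.Walk x y, ∀ z ∈ p.support, z ∈ S by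
    obtain ⟨p, hp⟩ := H
    exact ⟨p.bypass, p.bypass_isPath, fun z hz => hp z (p.support_bypass_subset_support hz)⟩
  induction h using Relation.ReflTransGen.head_induction_on with
  | refl => exact ⟨.nil, by simpa using hx⟩
  | head h _ ih =>
    obtain ⟨p, hp⟩ := ih h.2.2
    exact ⟨.cons h.1 p, by simpa using ⟨hx, hp⟩⟩

end ConnIn

/-- The vertices whose label is `a`, `b`, or the pair `ab`. -/
def bag {α β : Type*} (c : α → Option (Sym2 β)) (a b : β) : Set α :=
  {z | c z = some s(a, a) ∨ c z = some s(b, b) ∨ c z = some s(a, b)}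

theorem bag_comm {α β : Type*} (c : α → Option (Sym2 β)) (a b : β) : bag c a b = bag c b a := by
  ext z
  simp only [bag, Set.mem_ofPred_eq, Sym2.eq_swap (a := a) (b := b)]
  tauto

/-- A topological model of `H` in `G`, given by labels: the branch vertex `φ b` is the only vertex
labelled `s(b, b)`, the vertices labelled `s(a, b)` are available for a path from `φ a` to `φ b`,
and the vertices labelled `none` are unused. -/
structure SubdivModel {α β : Type*} (H : SimpleGraph β) (G : SimpleGraph α)
    (c : α → Option (Sym2 β)) (φ : β → α) : Prop where
  label_iff : ∀ x b, c x = some s(b, b) ↔ x = φ b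
  conn : ∀ a b, H.Adj a b → ConnIn G (bag c a b) (φ a) (φ b)

namespace SubdivModel

variable {α β : Type*} {H : SimpleGraph β} {G : SimpleGraph α} {c : α → Option (Sym2 β)}
  {φ : β → α}

theorem label (M : SubdivModel H G c φ) (b : β) : c (φ b) = some s(b, b) :=
  (M.label_iff _ _).2 rfl

theorem injective (M : SubdivModel H G c φ) : Function.Injective φ := by
  intro a b h
  have := M.label a
  rw [h, M.label b] at this
  simpa using this.symm

theorem left_mem (M : SubdivModel H G c φ) (a b : β) : φ a ∈ bag c a b := Or.inl (M.label a)

theorem right_mem (M : SubdivModel H G c φ) (a b : β) : φ b ∈ bag c a b :=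
  Or.inr (Or.inl (M.label b))

theorem mem_bag (M : SubdivModel H G c φ) {a b : β} {z : α} :
    z ∈ bag c a b ↔ z = φ a ∨ z = φ b ∨ c z = some s(a, b) := by
  simp [bag, M.label_iff]

/-- Two distinct vertices lie in at most one common bag. -/
theorem bag_unique (M : SubdivModel H G c φ) {x y : α} (hxy : x ≠ y) {a b a' b' : β}
    (hx : x ∈ bag c a b) (hy : y ∈ bag c a b) (hx' : x ∈ bag c a' b') (hy' : y ∈ bag c a' b')
    (hab : a ≠ b) (hab' : a' ≠ b') : s(a, b) = s(a', b') := by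
  have key : ∀ z t t', c z = some s(t, t) → c z = some s(t', t') → t = t' := by
    intro z t t' h h'
    rw [h] at h'
    simpa using h'
  have hne : ∀ t, c x = some s(t, t) → c y ≠ some s(t, t) := fun t h h' =>
    hxy (((M.label_iff _ _).1 h).trans ((M.label_iff _ _).1 h').symm)
  simp only [bag, Set.mem_ofPred_eq] at hx hy hx' hy'
  rcases hx with hx | hx | hx <;> rcases hy with hy | hy | hy <;>
    rcases hx' with hx' | hx' | hx' <;> rcases hy' with hy' | hy' | hy' <;>
    grind [Sym2.eq_iff]

/-- Models are transported along injective homomorphisms. -/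
theorem map {α' : Type*} {G' : SimpleGraph α'} (M : SubdivModel H G c φ) (f : G →g G')
    (hf : Function.Injective f) : ∃ c', SubdivModel H G' c' (f ∘ φ) := by
  classical
  refine ⟨fun y => if h : ∃ x, f x = y then c h.choose else none, ?_⟩
  have key : ∀ x, (if h : ∃ x', f x' = f x then c h.choose else none) = c x := by
    intro x
    have h : ∃ x', f x' = f x := ⟨x, rfl⟩
    rw [dif_pos h, hf h.choose_spec]
  constructor
  · intro y b
    by_cases h : ∃ x, f x = y
    · obtain ⟨x, rfl⟩ := h
      rw [key, M.label_iff]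
      exact hf.eq_iff.symm
    · simp only [h, dif_neg, not_false_eq_true, reduceCtorEq, false_iff]
      rintro rfl
      exact h ⟨_, rfl⟩
  · intro a b hab
    refine (M.conn a b hab).lift f fun x y hxy hx hy => ConnIn.of_adj (f.map_adj hxy) ?_ ?_
    · simpa only [bag, Set.mem_ofPred_eq, key] using hx
    · simpa only [bag, Set.mem_ofPred_eq, key] using hy

/-- An unused vertex can be removed from the host graph. -/
theorem induce (M : SubdivModel H G c φ) {s : Set α} (hs : ∀ v, v ∉ s → c v = none) :
    ∃ φ' : β → s, SubdivModel H (G.induce s) (fun z => c z) φ' := by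
  have hmem : ∀ x e, c x = some e → x ∈ s := by
    intro x e h
    by_contra hx
    simp [hs x hx] at h
  refine ⟨fun b => ⟨φ b, hmem _ _ (M.label b)⟩, fun x b => ?_, fun a b hab => ?_⟩
  · rw [M.label_iff, Subtype.ext_iff]
  · refine (M.conn a b hab).subtype (fun z hz => ?_) (fun x y _ _ h => h) _ _
    rcases hz with h | h | h <;> exact hmem _ _ h

/-- A vertex not needed for its connection can be made unused. -/
theorem erase [DecidableEq α] (M : SubdivModel H G c φ) {a b : β} {z : α} (hab : a ≠ b)
    (hz : c z = some s(a, b)) (hc : ConnIn G (bag c a b \ {z}) (φ a) (φ b)) :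
    SubdivModel H G (Function.update c z none) φ := by
  have hzb : ∀ t, c z ≠ some s(t, t) := by
    intro t h
    rw [hz] at h
    simp only [Option.some.injEq, Sym2.eq_iff, or_self] at h
    exact hab (h.1.trans h.2.symm)
  constructor
  · intro x t
    by_cases hx : x = z
    · subst hx
      simpa using fun h => hzb t ((M.label_iff _ _).2 h)
    · simpa [hx] using M.label_iff x t
  · intro a' b' h'
    have hsub : ∀ s t, bag c s t \ {z} ⊆ bag (Function.update c z none) s t := by
      rintro s t x ⟨hx, hxz⟩
      have hxz : x ≠ z := hxz
      simpa [bag, hxz] using hx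
    by_cases he : s(a', b') = s(a, b)
    · rcases Sym2.eq_iff.1 he with ⟨rfl, rfl⟩ | ⟨rfl, rfl⟩
      · exact hc.mono (hsub _ _)
      · rw [bag_comm c] at hc
        exact (hc.mono (hsub _ _)).symm
    · refine (M.conn a' b' h').mono fun x hx => hsub _ _ ⟨hx, ?_⟩
      rintro rfl
      rcases hx with h | h | h
      · exact hzb _ h
      · exact hzb _ h
      · rw [hz] at h
        exact he (by simpa using h.symm)

/-- Renaming the vertices of the model graph. -/
theorem transport {β' : Type*} {H' : SimpleGraph β'} (M : SubdivModel H G c φ) (e : β ≃ β')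
    (he : ∀ a b, H'.Adj (e a) (e b) → H.Adj a b) :
    SubdivModel H' G (fun z => (c z).map (Sym2.map e)) (φ ∘ e.symm) := by
  have key : ∀ z a b, (c z).map (Sym2.map e) = some s(e a, e b) ↔ c z = some s(a, b) := by
    intro z a b
    rw [← Sym2.map_mk, Option.map_eq_some_iff]
    constructor
    · rintro ⟨l, hl, hl'⟩
      rw [hl, Sym2.map.injective e.injective hl']
    · exact fun h => ⟨_, h, rfl⟩
  constructor
  · intro x b
    obtain ⟨b, rfl⟩ := e.surjective b
    rw [key, M.label_iff]
    simp
  · intro a b hab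
    obtain ⟨a, rfl⟩ := e.surjective a
    obtain ⟨b, rfl⟩ := e.surjective b
    have := M.conn a b (he a b hab)
    simpa [bag, key] using this

/-- An edge of the host between branch vertices can be added to the model graph. -/
theorem addEdge (M : SubdivModel H G c φ) {a b : β} (h : G.Adj (φ a) (φ b)) :
    SubdivModel (H ⊔ SimpleGraph.edge a b) G c φ := by
  refine ⟨M.label_iff, fun s t hst => ?_⟩
  rw [sup_adj, edge_adj] at hst
  rcases hst with hst | ⟨⟨rfl, rfl⟩ | ⟨rfl, rfl⟩, -⟩
  · exact M.conn s t hst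
  · exact .of_adj h (M.left_mem _ _) (M.right_mem _ _)
  · exact .of_adj h.symm (M.left_mem _ _) (M.right_mem _ _)

/-- A graph is a model of itself. -/
theorem id (H : SimpleGraph β) : SubdivModel H H (fun z => some s(z, z)) id := by
  refine ⟨fun x b => by simp, fun a b hab => .of_adj hab ?_ ?_⟩ <;> simp [bag]

/-- Models survive subdividing an edge of the host graph. -/
theorem subdivideEdge {n : ℕ} {G : SimpleGraph (Fin n)} {c : Fin n → Option (Sym2 β)}
    {φ : β → Fin n} (M : SubdivModel H G c φ) {u v : Fin n} (huv : G.Adj u v) :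
    ∃ c', SubdivModel H (IMWQO.subdivideEdge G u v) c' (fun b => (φ b).castSucc) := by
  classical
  have hl : ∃ l : Option (Sym2 β), (∀ t, l ≠ some s(t, t)) ∧
      ∀ a b, H.Adj a b → u ∈ bag c a b → v ∈ bag c a b → l = some s(a, b) := by
    by_cases h : ∃ a b, H.Adj a b ∧ u ∈ bag c a b ∧ v ∈ bag c a b
    · obtain ⟨a, b, hab, hu, hv⟩ := h
      refine ⟨some s(a, b), fun t ht => ?_, fun a' b' h' hu' hv' => ?_⟩
      · simp only [Option.some.injEq, Sym2.eq_iff, or_self] at ht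
        exact hab.ne (ht.1.trans ht.2.symm)
      · rw [M.bag_unique huv.ne hu hv hu' hv' hab.ne h'.ne]
    · exact ⟨none, by simp, fun a b hab hu hv => (h ⟨a, b, hab, hu, hv⟩).elim⟩
  obtain ⟨l, hl, hl'⟩ := hl
  refine ⟨Fin.lastCases l c, fun x b => ?_, fun a b hab => ?_⟩
  · induction x using Fin.lastCases with
    | last => simpa [hl] using (Fin.castSucc_lt_last (φ b)).ne'
    | cast x => simpa using M.label_iff x b
  · have hcast : ∀ x ∈ bag c a b,
        x.castSucc ∈ bag (Fin.lastCases (motive := fun _ => _) l c) a b := by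
      intro x hx
      simpa [bag] using hx
    refine (M.conn a b hab).lift Fin.castSucc fun x y hxy hx hy => ?_
    by_cases h : (x = u ∧ y = v) ∨ (x = v ∧ y = u)
    · have hlast : Fin.last n ∈ bag (Fin.lastCases (motive := fun _ => _) l c) a b := by
        right; right
        rcases h with ⟨rfl, rfl⟩ | ⟨rfl, rfl⟩ <;> simpa using hl' a b hab ‹_› ‹_›
      have h1 : x = u ∨ x = v := by tauto
      have h2 : y = u ∨ y = v := by tauto
      refine (ConnIn.of_adj (y := Fin.last n) ?_ (hcast x hx) hlast).trans
        (ConnIn.of_adj ?_ hlast (hcast y hy))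
      · simp only [IMWQO.subdivideEdge, fromRel_adj]
        exact ⟨(Fin.castSucc_lt_last x).ne, Or.inr (Or.inr ⟨trivial, by simpa using h1⟩)⟩
      · simp only [IMWQO.subdivideEdge, fromRel_adj]
        exact ⟨(Fin.castSucc_lt_last y).ne', Or.inl (Or.inr ⟨trivial, by simpa using h2⟩)⟩
    · refine .of_adj ?_ (hcast x hx) (hcast y hy)
      simp only [IMWQO.subdivideEdge, fromRel_adj]
      refine ⟨by simpa using hxy.ne, Or.inl (Or.inl ⟨x, y, rfl, rfl, hxy, ?_, ?_⟩)⟩ <;> tauto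

end SubdivModel

theorem exists_model_of_reflTransGen {β : Type*} {H : SimpleGraph β} {A B : FinGraph}
    (hAB : Relation.ReflTransGen SubdivStep A B) (hB : ∃ c φ, SubdivModel H B.2 c φ) :
    ∃ c φ, SubdivModel H A.2 c φ := by
  induction hAB using Relation.ReflTransGen.head_induction_on with
  | refl => exact hB
  | head hs _ ih =>
    obtain ⟨c, φ, M⟩ := ih
    obtain @⟨n, G, u, v, h⟩ := hs
    obtain ⟨c', M'⟩ := SubdivModel.subdivideEdge M h
    exact ⟨c', _, M'⟩

/-- A graph containing a subdivision of `H` has a topological model of `H`. -/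
theorem ContainsSubdivAsSubgraph.exists_model {α β : Type*} {G : SimpleGraph α}
    {H : SimpleGraph β} (h : ContainsSubdivAsSubgraph G H) :
    ∃ c φ, SubdivModel H G c φ := by
  obtain ⟨S, A, B, ⟨f⟩, ⟨g⟩, hAB⟩ := h
  obtain ⟨c₀, M₀⟩ := (SubdivModel.id H).map g.toHom g.injective
  obtain ⟨c, φ, M⟩ := exists_model_of_reflTransGen hAB ⟨c₀, _, M₀⟩
  obtain ⟨c', M'⟩ := M.map (S.hom.comp f.symm.toHom)
    (S.hom_injective.comp f.symm.injective)
  exact ⟨c', _, M'⟩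

theorem IsSubdivision.of_iso {α β : Type*} [Finite β] {G : SimpleGraph α} {H : SimpleGraph β}
    (f : G ≃g H) : IsSubdivision G H := by
  classical
  cases nonempty_fintype β
  exact ⟨⟨_, H.overFin rfl⟩, ⟨_, H.overFin rfl⟩, ⟨f.trans (H.overFinIso rfl)⟩,
    ⟨H.overFinIso rfl⟩, .refl⟩

/-- If `w` has exactly two neighbours `a` and `t`, which are not adjacent, and suppressing `w`
yields a subdivision of `H`, then `G` is a subdivision of `H`. -/
theorem IsSubdivision.of_suppress {α β : Type*} {G : SimpleGraph α} {H : SimpleGraph β}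
    {w a t : α} (hw : ∀ x, G.Adj w x ↔ x = a ∨ x = t) (hna : ¬ G.Adj a t) (hat : a ≠ t)
    {G' : SimpleGraph {x // x ≠ w}}
    (hG' : ∀ x y, G'.Adj x y ↔ G.Adj x y ∨ (x.1 = a ∧ y.1 = t) ∨ (x.1 = t ∧ y.1 = a))
    (h : IsSubdivision G' H) : IsSubdivision G H := by
  classical
  obtain ⟨⟨n, A⟩, B, ⟨f⟩, hg, hAB⟩ := h
  change G' ≃g A at f
  have haw : a ≠ w := ((hw a).2 (Or.inl rfl)).ne'
  have htw : t ≠ w := ((hw t).2 (Or.inr rfl)).ne'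
  have hadj : A.Adj (f ⟨a, haw⟩) (f ⟨t, htw⟩) := by
    rw [f.map_adj_iff, hG']
    simp
  refine ⟨⟨n + 1, IMWQO.subdivideEdge A (f ⟨a, haw⟩) (f ⟨t, htw⟩)⟩, B, ?_, hg,
    .head (.mk A _ _ hadj) hAB⟩
  let e : α → Fin (n + 1) := fun x => if h : x ≠ w then (f ⟨x, h⟩).castSucc else Fin.last n
  have ew : e w = Fin.last n := by simp [e]
  have en : ∀ x (h : x ≠ w), e x = (f ⟨x, h⟩).castSucc := fun x h => by simp [e, h]
  have einj : Function.Injective e := by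
    intro x y hxy
    by_cases hx : x = w <;> by_cases hy : y = w
    · rw [hx, hy]
    · rw [hx, ew, en y hy] at hxy
      exact ((Fin.castSucc_lt_last _).ne' hxy).elim
    · rw [hy, ew, en x hx] at hxy
      exact ((Fin.castSucc_lt_last _).ne hxy).elim
    · rw [en x hx, en y hy] at hxy
      simpa using hxy
  have esurj : Function.Surjective e := by
    intro y
    induction y using Fin.lastCases with
    | last => exact ⟨w, ew⟩
    | cast y =>
      obtain ⟨x, rfl⟩ := f.surjective y
      exact ⟨x.1, en x.1 x.2⟩
  have ebij : Function.Bijective e := ⟨einj, esurj⟩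
  refine ⟨⟨Equiv.ofBijective e ebij, ?_⟩⟩
  intro x y
  change (IMWQO.subdivideEdge A (f ⟨a, haw⟩) (f ⟨t, htw⟩)).Adj (e x) (e y) ↔ _
  simp only [subdivideEdge, fromRel_adj]
  have hl : ∀ v : Fin n, Fin.last n ≠ v.castSucc := fun v => (Fin.castSucc_lt_last v).ne'
  have hl' : ∀ v : Fin n, v.castSucc ≠ Fin.last n := fun v => (Fin.castSucc_lt_last v).ne
  by_cases hx : x = w <;> by_cases hy : y = w
  · subst hx; subst hy
    simp
  · subst hx
    rw [ew, en y hy, hw]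
    simp [hl, hl', f.injective.eq_iff]
  · subst hy
    rw [ew, en x hx, G.adj_comm, hw]
    simp [hl, hl', f.injective.eq_iff]
  · rw [en x hx, en y hy]
    simp only [ne_eq, Fin.castSucc_inj, f.injective.eq_iff, hl', false_and, or_false,
      Subtype.mk.injEq]
    have h1 : ∀ x y (hx : x ≠ w) (hy : y ≠ w), (∃ a' b', f ⟨x, hx⟩ = a' ∧ f ⟨y, hy⟩ = b' ∧
        A.Adj a' b' ∧ ¬(a' = f ⟨a, haw⟩ ∧ b' = f ⟨t, htw⟩) ∧
        ¬(a' = f ⟨t, htw⟩ ∧ b' = f ⟨a, haw⟩)) ↔ G.Adj x y := by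
      intro x y hx hy
      constructor
      · rintro ⟨_, _, rfl, rfl, h1, h2, h3⟩
        rw [f.map_adj_iff, hG'] at h1
        simp only [f.injective.eq_iff, Subtype.mk.injEq] at h2 h3
        tauto
      · intro h
        refine ⟨_, _, rfl, rfl, by rw [f.map_adj_iff, hG']; exact Or.inl h, ?_, ?_⟩
        · simp only [f.injective.eq_iff, Subtype.mk.injEq]
          rintro ⟨rfl, rfl⟩
          exact hna h
        · simp only [f.injective.eq_iff, Subtype.mk.injEq]
          rintro ⟨rfl, rfl⟩
          exact hna h.symm
    rw [h1 x y hx hy, h1 y x hy hx, G.adj_comm y x, or_self]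
    exact ⟨fun h => h.2, fun h => ⟨h.ne, h⟩⟩

/-- A model that uses all vertices and edges of the host and whose connections are minimal. -/
structure SubdivModel.IsTight {α β : Type*} {H : SimpleGraph β} {G : SimpleGraph α}
    {c : α → Option (Sym2 β)} {φ : β → α} (M : SubdivModel H G c φ) : Prop where
  label_edge : ∀ z, (∃ a, z = φ a) ∨ ∃ a b, H.Adj a b ∧ c z = some s(a, b)
  adj_bag : ∀ x y, G.Adj x y → ∃ a b, H.Adj a b ∧ x ∈ bag c a b ∧ y ∈ bag c a b
  minimal : ∀ a b z, H.Adj a b → c z = some s(a, b) →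
    ¬ ConnIn G (bag c a b \ {z}) (φ a) (φ b)

namespace SubdivModel

variable {α β : Type*} {H : SimpleGraph β} {G : SimpleGraph α} {c : α → Option (Sym2 β)}
  {φ : β → α}

theorem ne_of_label (M : SubdivModel H G c φ) {a b : β} (hab : a ≠ b) {z : α}
    (hz : c z = some s(a, b)) (t : β) : z ≠ φ t := by
  rintro rfl
  rw [M.label t] at hz
  simp only [Option.some.injEq, Sym2.eq_iff] at hz
  rcases hz with ⟨rfl, rfl⟩ | ⟨rfl, rfl⟩ <;> exact hab rfl

theorem label_eq_of_mem_bag (M : SubdivModel H G c φ) {a b a' b' : β} (hab : a ≠ b) {z : α}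
    (hz : c z = some s(a, b)) (hz' : z ∈ bag c a' b') : s(a, b) = s(a', b') := by
  rcases M.mem_bag.1 hz' with h | h | h
  · exact (M.ne_of_label hab hz _ h).elim
  · exact (M.ne_of_label hab hz _ h).elim
  · rw [hz] at h
    simpa using h

theorem bag_congr {a b a' b' : β} (h : s(a, b) = s(a', b')) : bag c a b = bag c a' b' := by
  rcases Sym2.eq_iff.1 h with ⟨rfl, rfl⟩ | ⟨rfl, rfl⟩
  · rfl
  · exact bag_comm _ _ _

namespace IsTight

theorem isSubdivision_of_forall_branch [Finite β] {M : SubdivModel H G c φ} (hM : M.IsTight)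
    (hφ : ∀ z, ∃ a, z = φ a) : IsSubdivision G H := by
  have hbij : Function.Bijective φ := ⟨M.injective, fun z => (hφ z).imp fun _ h => h.symm⟩
  refine IsSubdivision.of_iso (Iso.symm ⟨Equiv.ofBijective φ hbij, ?_⟩)
  intro a b
  change G.Adj (φ a) (φ b) ↔ _
  have hbag : ∀ {s t u}, φ s ∈ bag c t u → s = t ∨ s = u := by
    intro s t u h
    rcases h with h | h | h <;> rw [M.label] at h <;>
      simp only [Option.some.injEq, Sym2.eq_iff] at h <;> tauto
  constructor
  · intro h
    obtain ⟨a', b', h', ha, hb⟩ := hM.adj_bag _ _ h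
    have hne : a ≠ b := fun e => h.ne (congrArg φ e)
    rcases hbag ha with rfl | rfl <;> rcases hbag hb with rfl | rfl
    · exact (hne rfl).elim
    · exact h'
    · exact h'.symm
    · exact (hne rfl).elim
  · intro h
    rcases Relation.ReflTransGen.cases_head (M.conn a b h) with h' | ⟨y, ⟨hy, -, hyb⟩, -⟩
    · exact (h.ne (M.injective h')).elim
    · obtain ⟨s, rfl⟩ := hφ y
      rcases hbag hyb with rfl | rfl
      · exact (hy.ne rfl).elim
      · exact hy

/-- A tight model with an inner path vertex has one that can be suppressed. -/
theorem exists_suppressible {M : SubdivModel H G c φ} (hM : M.IsTight) {a b : β}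
    (hab : H.Adj a b) {z : α} (hz : c z = some s(a, b)) :
    ∃ w t, c w = some s(a, b) ∧ (∀ x, G.Adj w x ↔ x = φ a ∨ x = t) ∧ ¬ G.Adj (φ a) t ∧
      φ a ≠ t ∧ t ∈ bag c a b ∧ ConnIn G (bag c a b \ {w}) t (φ b) := by
  classical
  obtain ⟨p, hp, hpb⟩ := (M.conn a b hab).exists_isPath (M.left_mem a b)
  have hcov : ∀ z, c z = some s(a, b) → z ∈ p.support := by
    intro z hz
    by_contra h
    refine hM.minimal a b z hab hz (.of_walk p fun x hx => ⟨hpb x hx, ?_⟩)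
    rintro rfl
    exact h hx
  have hne : φ a ≠ φ b := fun h => hab.ne (M.injective h)
  obtain ⟨w, haw, p, rfl⟩ : ∃ w, ∃ (h : G.Adj (φ a) w) (q : G.Walk w (φ b)), p = .cons h q :=
    p.exists_eq_cons_of_ne hne
  rw [Walk.cons_isPath_iff] at hp
  simp only [Walk.support_cons, List.mem_cons, forall_eq_or_imp] at hpb hcov
  have hwb : w ≠ φ b := by
    rintro rfl
    rw [(Walk.isPath_iff_nil.1 hp.1).eq_nil] at hcov
    rcases hcov z hz with h | h
    · exact M.ne_of_label hab.ne hz _ h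
    · exact M.ne_of_label hab.ne hz _ (by simpa using h)
  have hcw : c w = some s(a, b) := by
    rcases M.mem_bag.1 (hpb.2 w p.start_mem_support) with h | h | h
    · exact (haw.ne h.symm).elim
    · exact (hwb h).elim
    · exact h
  obtain ⟨t, hwt, p, rfl⟩ : ∃ t, ∃ (h : G.Adj w t) (q : G.Walk t (φ b)), p = .cons h q :=
    p.exists_eq_cons_of_ne hwb
  rw [Walk.cons_isPath_iff] at hp
  simp only [Walk.support_cons, List.mem_cons, forall_eq_or_imp, not_or] at hpb hcov hp
  obtain ⟨⟨hpp, hwp⟩, -, hap⟩ := hp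
  have hpw : ∀ x ∈ p.support, x ∈ bag c a b \ {w} := by
    intro x hx
    refine ⟨hpb.2.2 x hx, ?_⟩
    rintro rfl
    exact hwp hx
  refine ⟨w, t, hcw, fun x => ⟨fun hx => ?_, ?_⟩, fun h => ?_, ?_,
    hpb.2.2 _ p.start_mem_support, .of_walk p hpw⟩
  · by_contra hxx
    rw [not_or] at hxx
    obtain ⟨a', b', h', hw', hx'⟩ := hM.adj_bag _ _ hx
    rw [← bag_congr (M.label_eq_of_mem_bag hab.ne hcw hw')] at hx'
    have hxp : x ∈ p.support := by
      rcases M.mem_bag.1 hx' with h | h | h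
      · exact (hxx.1 h).elim
      · rw [h]
        exact p.end_mem_support
      · rcases hcov x h with h | h | h
        · exact (hxx.1 h).elim
        · exact (hx.ne h.symm).elim
        · exact h
    obtain ⟨r, htr, p, rfl⟩ :
        ∃ r, ∃ (h : G.Adj t r) (q : G.Walk r (φ b)), p = .cons h q := by
      cases hp' : p with
      | nil =>
        subst hp'
        exact (hxx.2 (by simpa using hxp)).elim
      | cons h q => exact ⟨_, h, q, rfl⟩
    rw [Walk.cons_isPath_iff] at hpp
    simp only [Walk.support_cons, List.mem_cons, forall_eq_or_imp, not_or] at hpb hap hpw hxp hwp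
    replace hxp : x ∈ p.support := hxp.resolve_left hxx.2
    have hct : c t = some s(a, b) := by
      rcases M.mem_bag.1 hpb.2.2.1 with h | h | h
      · exact (hap.1 h.symm).elim
      · exact (hpp.2 (h ▸ p.end_mem_support)).elim
      · exact h
    refine hM.minimal a b t hab hct (.of_walk (.cons haw (.cons hx (p.dropUntil x hxp))) ?_)
    intro y hy
    simp only [Walk.support_cons, List.mem_cons] at hy
    refine ⟨?_, ?_⟩
    · rcases hy with rfl | rfl | hy
      · exact hpb.1
      · exact hpb.2.1
      · exact hpb.2.2.2 y (p.support_dropUntil_subset_support hxp hy)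
    · rintro rfl
      rcases hy with rfl | rfl | hy
      · exact hap.1 rfl
      · exact hwp.1 rfl
      · exact hpp.2 (p.support_dropUntil_subset_support hxp hy)
  · rintro (rfl | rfl)
    · exact haw.symm
    · exact hwt
  · refine hM.minimal a b w hab hcw (.of_walk (.cons h p) ?_)
    intro y hy
    rw [Walk.support_cons, List.mem_cons] at hy
    rcases hy with rfl | hy
    · exact ⟨hpb.1, haw.ne⟩
    · exact hpw y hy
  · rintro rfl
    exact hap p.start_mem_support

/-- A graph with a tight model of `H` is a subdivision of `H`. -/
theorem isSubdivision {α β : Type*} [Finite α] [Finite β] {H : SimpleGraph β}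
    {G : SimpleGraph α} {c : α → Option (Sym2 β)} {φ : β → α} {M : SubdivModel H G c φ}
    (hM : M.IsTight) : IsSubdivision G H := by
  classical
  induction hn : Nat.card α using Nat.strong_induction_on generalizing α with
  | _ n ih =>
  by_cases hbr : ∀ z, ∃ a, z = φ a
  · exact hM.isSubdivision_of_forall_branch hbr
  push Not at hbr
  obtain ⟨z, hz⟩ := hbr
  obtain ⟨a, b, hab, hz⟩ := (hM.label_edge z).resolve_left (by simpa using hz)
  obtain ⟨w, t, hcw, hw, hna, hat, htb, hconn⟩ := hM.exists_suppressible hab hz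
  have hφw : ∀ s, φ s ≠ w := fun s h => M.ne_of_label hab.ne hcw s h.symm
  have htw : t ≠ w := ((hw t).2 (Or.inr rfl)).ne'
  let G' : SimpleGraph {x // x ≠ w} :=
    G.comap Subtype.val ⊔ SimpleGraph.edge ⟨φ a, hφw a⟩ ⟨t, htw⟩
  have hG' : ∀ x y, G'.Adj x y ↔
      G.Adj x y ∨ (x.1 = φ a ∧ y.1 = t) ∨ (x.1 = t ∧ y.1 = φ a) := by
    intro x y
    simp only [G', sup_adj, comap_adj, edge_adj, Subtype.ext_iff, ne_eq]
    constructor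
    · tauto
    · rintro (h | ⟨h, h'⟩ | ⟨h, h'⟩)
      · exact Or.inl h
      · refine Or.inr ⟨Or.inl ⟨h, h'⟩, ?_⟩
        rw [h, h']
        exact hat
      · refine Or.inr ⟨Or.inr ⟨h, h'⟩, ?_⟩
        rw [h, h']
        exact hat.symm
  let φ' : β → {x // x ≠ w} := fun s => ⟨φ s, hφw s⟩
  have hsub : ∀ (S : Set α) x y (hx : x ≠ w) (hy : y ≠ w), w ∉ S → ConnIn G S x y →
      ConnIn G' (Subtype.val ⁻¹' S) ⟨x, hx⟩ ⟨y, hy⟩ := by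
    intro S x y hx hy hS h
    exact h.subtype (P := fun x => x ≠ w) (fun z hz (hzw : z = w) => hS (hzw ▸ hz))
      (fun x y _ _ hxy => (hG' _ _).2 (Or.inl hxy)) hx hy
  have hab' : ConnIn G' (bag (fun x : {x // x ≠ w} => c x) a b) (φ' a) (φ' b) := by
    refine (ConnIn.of_adj (G := G') (y := ⟨t, htw⟩) ?_ (M.left_mem a b) htb).trans
      ((hsub _ _ _ htw (hφw b) (by simp) hconn).mono fun x hx => hx.1)
    rw [hG']
    simp [φ']
  have M' : SubdivModel H G' (fun x => c x) φ' := by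
    refine ⟨fun x s => ?_, fun a' b' h' => ?_⟩
    · rw [M.label_iff, Subtype.ext_iff]
    · by_cases he : s(a', b') = s(a, b)
      · rcases Sym2.eq_iff.1 he with ⟨rfl, rfl⟩ | ⟨rfl, rfl⟩
        · exact hab'
        · rw [bag_comm]
          exact hab'.symm
      · exact hsub _ _ _ (hφw a') (hφw b')
          (fun h => he (M.label_eq_of_mem_bag hab.ne hcw h).symm) (M.conn a' b' h')
  refine IsSubdivision.of_suppress hw hna hat hG' (ih (Nat.card {x // x ≠ w}) ?_ (M := M') ?_ rfl)
  · rw [← hn]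
    exact Finite.card_subtype_lt (x := w) (by simp)
  · refine ⟨fun x => ?_, fun x y h => ?_, fun a' b' z' h' hz' hc => ?_⟩
    · rcases hM.label_edge x with ⟨s, hs⟩ | h
      · exact Or.inl ⟨s, Subtype.ext hs⟩
      · exact Or.inr h
    · rcases (hG' _ _).1 h with h | ⟨hx, hy⟩ | ⟨hx, hy⟩
      · exact hM.adj_bag _ _ h
      · exact ⟨a, b, hab, by simpa [bag, hx] using M.left_mem a b, by simpa [bag, hy] using htb⟩
      · exact ⟨a, b, hab, by simpa [bag, hx] using htb, by simpa [bag, hy] using M.left_mem a b⟩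
    · refine hM.minimal a' b' z' h' hz' (hc.lift Subtype.val fun x y hxy hx hy => ?_)
      have hx' : x.1 ∈ bag c a' b' \ {z'.1} := ⟨hx.1, fun h => hx.2 (Subtype.ext h)⟩
      have hy' : y.1 ∈ bag c a' b' \ {z'.1} := ⟨hy.1, fun h => hy.2 (Subtype.ext h)⟩
      have hwmem : φ a ∈ bag c a' b' → t ∈ bag c a' b' → w ∈ bag c a' b' \ {z'.1} := by
        intro h1 h2
        refine ⟨?_, fun h => z'.2 h.symm⟩
        rw [← bag_congr (M.bag_unique hat (M.left_mem a b) htb h1 h2 hab.ne h'.ne)]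
        exact Or.inr (Or.inr hcw)
      rcases (hG' _ _).1 hxy with h | ⟨h1, h2⟩ | ⟨h1, h2⟩
      · exact .of_adj h hx' hy'
      · have hwm := hwmem (h1 ▸ hx'.1) (h2 ▸ hy'.1)
        refine (ConnIn.of_adj (y := w) ?_ hx' hwm).trans (.of_adj ?_ hwm hy')
        · rw [h1, G.adj_comm, hw]
          exact Or.inl rfl
        · rw [h2, hw]
          exact Or.inr rfl
      · have hwm := hwmem (h2 ▸ hy'.1) (h1 ▸ hx'.1)
        refine (ConnIn.of_adj (y := w) ?_ hx' hwm).trans (.of_adj ?_ hwm hy')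
        · rw [h1, G.adj_comm, hw]
          exact Or.inr rfl
        · rw [h2, hw]
          exact Or.inl rfl

end IsTight

end SubdivModel

namespace SubdivModel

variable {α β : Type*} {H : SimpleGraph β} {G : SimpleGraph α} {c : α → Option (Sym2 β)}
  {φ : β → α}

/-- Every model can be thinned out to one with minimal connections. -/
theorem exists_minimal [Finite α] (M : SubdivModel H G c φ) :
    ∃ c', SubdivModel H G c' φ ∧ ∀ a b z, H.Adj a b → c' z = some s(a, b) →
      ¬ ConnIn G (bag c' a b \ {z}) (φ a) (φ b) := by
  classical
  induction hn : {z | c z ≠ none}.ncard using Nat.strong_induction_on generalizing c with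
  | _ n ih =>
  by_cases h : ∀ a b z, H.Adj a b → c z = some s(a, b) →
      ¬ ConnIn G (bag c a b \ {z}) (φ a) (φ b)
  · exact ⟨c, M, h⟩
  push Not at h
  obtain ⟨a, b, z, hab, hz, hc⟩ := h
  refine ih _ ?_ (M.erase hab.ne hz hc) rfl
  rw [← hn]
  refine Set.ncard_lt_ncard ⟨fun x hx => ?_, fun hsub => ?_⟩
  · by_cases hxz : x = z
    · simp [hxz] at hx
    · simpa [hxz] using hx
  · have : z ∈ {x | Function.update c z none x ≠ none} := hsub (by simp [hz])
    simp at this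

/-- A graph with a topological model of `H` contains a subdivision of `H`. -/
theorem containsSubdiv [Finite α] [Finite β] (M : SubdivModel H G c φ) :
    ContainsSubdivAsSubgraph G H := by
  obtain ⟨c, M, hmin⟩ := M.exists_minimal
  have hbag : ∀ {a b x}, H.Adj a b → x ∈ bag c a b →
      (∃ a, x = φ a) ∨ ∃ a b, H.Adj a b ∧ c x = some s(a, b) := by
    intro a b x hab hx
    rcases M.mem_bag.1 hx with h | h | h
    · exact Or.inl ⟨_, h⟩
    · exact Or.inl ⟨_, h⟩
    · exact Or.inr ⟨_, _, hab, h⟩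
  let S : G.Subgraph :=
    { verts := {x | (∃ a, x = φ a) ∨ ∃ a b, H.Adj a b ∧ c x = some s(a, b)}
      Adj := fun x y => G.Adj x y ∧ ∃ a b, H.Adj a b ∧ x ∈ bag c a b ∧ y ∈ bag c a b
      adj_sub := fun h => h.1
      edge_vert := by
        rintro x y ⟨-, a, b, hab, hx, -⟩
        exact hbag hab hx
      symm := ⟨by
        rintro x y ⟨h, a, b, hab, hx, hy⟩
        exact ⟨h.symm, a, b, hab, hy, hx⟩⟩ }
  have M' : SubdivModel H S.coe (fun z => c z) (fun b => ⟨φ b, Or.inl ⟨b, rfl⟩⟩) := by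
    refine ⟨fun x b => ?_, fun a b hab => ?_⟩
    · rw [M.label_iff, Subtype.ext_iff]
    · exact (M.conn a b hab).subtype (P := fun x => x ∈ S.verts) (G' := S.coe)
        (fun x hx => hbag hab hx)
        (fun x y hx hy h => ⟨h, a, b, hab, hx, hy⟩) _ _
  refine ⟨S, IsTight.isSubdivision (M := M') ⟨fun z => ?_, fun x y h => h.2, ?_⟩⟩
  · rcases z.2 with ⟨a, ha⟩ | h
    · exact Or.inl ⟨a, Subtype.ext ha⟩
    · exact Or.inr h
  · intro a b z hab hz hc
    refine hmin a b z hab hz (hc.lift (G := S.coe) Subtype.val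
      fun x y hxy hx hy => .of_adj hxy.1 ?_ ?_)
    · exact ⟨hx.1, fun h => hx.2 (Subtype.ext h)⟩
    · exact ⟨hy.1, fun h => hy.2 (Subtype.ext h)⟩

/-- A model of `K₄` with an unused vertex is a proper `K₄`-subdivision. -/
theorem hasProperK4Subdivision [Finite α] {c : α → Option (Sym2 (Fin 4))} {φ : Fin 4 → α}
    (M : SubdivModel K4 G c φ) {v : α} (hv : c v = none) : HasProperK4Subdivision G := by
  obtain ⟨φ', M'⟩ := M.induce (s := {u | u ≠ v}) (by simpa using hv)
  exact ⟨v, M'.containsSubdiv⟩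

end SubdivModel

/-- The graph obtained from `H` by subdividing the edge `ab`, the new vertex being `none`. -/
def splitEdge {β : Type*} (H : SimpleGraph β) (a b : β) : SimpleGraph (Option β) where
  Adj x y := match x, y with
    | none, none => False
    | none, some y => y = a ∨ y = b
    | some x, none => x = a ∨ x = b
    | some x, some y => H.Adj x y ∧ s(x, y) ≠ s(a, b)
  symm := ⟨by
    rintro (_ | x) (_ | y) h
    · exact h
    · exact h
    · exact h
    · exact ⟨h.1.symm, by rw [Sym2.eq_swap]; exact h.2⟩⟩
  loopless := ⟨by
    rintro (_ | x) h
    · exact h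
    · exact h.1.ne rfl⟩

instance {β : Type*} [DecidableEq β] (H : SimpleGraph β) [DecidableRel H.Adj] (a b : β) :
    DecidableRel (splitEdge H a b).Adj := fun x y => by
  unfold splitEdge
  cases x <;> cases y <;> dsimp only <;> infer_instance

/-- A vertex that is essential for the connection of `a` and `b` becomes a branch vertex of a model
of the graph in which `ab` is subdivided. -/
theorem SubdivModel.split {α β : Type*} {H : SimpleGraph β} {G : SimpleGraph α}
    {c : α → Option (Sym2 β)} {φ : β → α} (M : SubdivModel H G c φ) {a b : β} (hab : H.Adj a b)
    {x : α} (hx : c x = some s(a, b))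
    (hmin : ¬ ConnIn G (bag c a b \ {x}) (φ a) (φ b)) :
    ∃ c', SubdivModel (splitEdge H a b) G c' (fun o => o.elim x φ) ∧
      (∀ z e, c z = some e → e ≠ s(a, b) → c' z = some (e.map some)) ∧
      ∀ z, c z = some s(a, b) → z ≠ x →
        c' z = some s(none, some a) ∨ c' z = some s(none, some b) := by
  classical
  obtain ⟨p, hp, hpb⟩ := (M.conn a b hab).exists_isPath (M.left_mem a b)
  have hxp : x ∈ p.support := by
    by_contra h
    refine hmin (.of_walk p fun y hy => ⟨hpb y hy, ?_⟩)
    rintro rfl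
    exact h hy
  obtain ⟨q, r, rfl⟩ := (Walk.mem_support_iff_exists_append).1 hxp
  have hdis : ∀ z ∈ q.support, z ∈ r.support → z = x := by
    intro z hz hz'
    by_contra hzx
    exact hp.ne_of_mem_support_of_append hzx hz hz' rfl
  simp only [Walk.mem_support_append_iff] at hpb
  have hφx : ∀ t, x ≠ φ t := M.ne_of_label hab.ne hx
  have hφe : ∀ t, c (φ t) ≠ some s(a, b) := fun t h => M.ne_of_label hab.ne h t rfl
  let c' : α → Option (Sym2 (Option β)) := fun z =>
    if z = x then some s(none, none) else
    if c z = some s(a, b) then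
      if z ∈ q.support then some s(none, some a) else some s(none, some b)
    else (c z).map (Sym2.map some)
  have c'x : c' x = some s(none, none) := by simp [c']
  have c'e : ∀ z e, c z = some e → e ≠ s(a, b) → c' z = some (e.map some) := by
    intro z e hz he
    have hzx : z ≠ x := by
      rintro rfl
      rw [hx] at hz
      exact he (by simpa using hz.symm)
    simp [c', hzx, hz, he]
  have c'φ : ∀ t, c' (φ t) = some s(some t, some t) := fun t =>
    c'e _ _ (M.label t) (by have := hφe t; rw [M.label] at this; simpa using this)
  have c'q : ∀ z, c z = some s(a, b) → z ≠ x → z ∈ q.support →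
      c' z = some s(none, some a) := by
    intro z hz hzx hzq
    simp [c', hz, hzx, hzq]
  have c'r : ∀ z, c z = some s(a, b) → z ≠ x → z ∉ q.support →
      c' z = some s(none, some b) := by
    intro z hz hzx hzq
    simp [c', hz, hzx, hzq]
  have ha : ConnIn G (bag c' none (some a)) x (φ a) := by
    refine ConnIn.symm (.of_walk q fun z hz => ?_)
    by_cases hzx : z = x
    · exact Or.inl (hzx ▸ c'x)
    rcases M.mem_bag.1 (hpb z (Or.inl hz)) with h | h | h
    · exact Or.inr (Or.inl (h ▸ c'φ a))
    · exact (hzx (hdis z hz (h ▸ r.end_mem_support))).elim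
    · exact Or.inr (Or.inr (c'q z h hzx hz))
  have hb : ConnIn G (bag c' none (some b)) x (φ b) := by
    refine .of_walk r fun z hz => ?_
    by_cases hzx : z = x
    · exact Or.inl (hzx ▸ c'x)
    rcases M.mem_bag.1 (hpb z (Or.inr hz)) with h | h | h
    · exact (hzx (hdis z (h ▸ q.start_mem_support) hz)).elim
    · exact Or.inr (Or.inl (h ▸ c'φ b))
    · exact Or.inr (Or.inr (c'r z h hzx fun hzq => hzx (hdis z hzq hz)))
  refine ⟨c', ⟨?_, ?_⟩, c'e, fun z hz hzx => ?_⟩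
  · rintro z (_ | t)
    · refine ⟨fun h => ?_, fun h => h ▸ c'x⟩
      by_contra hzx
      have hzx : z ≠ x := hzx
      simp only [c', hzx, if_false] at h
      split_ifs at h
      · simp at h
      · simp at h
      · obtain ⟨e, -, he⟩ := Option.map_eq_some_iff.1 h
        have : (none : Option β) ∈ e.map some := by simp [he]
        simp [Sym2.mem_map] at this
    · refine ⟨fun h => ?_, fun h => h ▸ c'φ t⟩
      by_cases hzx : z = x
      · rw [hzx, c'x] at h
        simp at h
      simp only [c', hzx, if_false] at h
      split_ifs at h
      · simp at h
      · simp at h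
      · obtain ⟨e, he, he'⟩ := Option.map_eq_some_iff.1 h
        have : e = s(t, t) :=
          Sym2.map.injective (Option.some_injective β) (by rw [he', Sym2.map_mk])
        rw [this] at he
        exact (M.label_iff z t).1 he
  · rintro (_ | s) (_ | t) hst
    · exact hst.elim
    · rcases hst with rfl | rfl
      · exact ha
      · exact hb
    · rw [bag_comm]
      rcases hst with rfl | rfl
      · exact ha.symm
      · exact hb.symm
    · refine (M.conn s t hst.1).mono fun z hz => ?_
      rcases M.mem_bag.1 hz with h | h | h
      · exact Or.inl (h ▸ c'φ s)
      · exact Or.inr (Or.inl (h ▸ c'φ t))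
      · exact Or.inr (Or.inr (c'e z _ h hst.2))
  · by_cases hzq : z ∈ q.support
    · exact Or.inl (c'q z hz hzx hzq)
    · exact Or.inr (c'r z hz hzx hzq)

/-- Candidate data for a topological model of `K₄` in a graph on `β`: four branch vertices and the
inner vertices of the paths joining them. -/
structure K4Route (β : Type*) where
  branch : Fin 4 → β
  inner : Fin 4 → Fin 4 → List β

namespace K4Route

variable {β : Type*}

/-- The path from the `i`-th to the `j`-th branch vertex. -/
def path (R : K4Route β) (i j : Fin 4) : List β := R.branch i :: (R.inner i j ++ [R.branch j])

/-- The inner vertices (as loops) and the edges of the path from branch `i` to branch `j`. -/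
def elements (R : K4Route β) (i j : Fin 4) : List (Sym2 β) :=
  (R.inner i j).map (fun x => s(x, x)) ++
    List.zipWith (fun x y => s(x, y)) (R.path i j) (R.path i j).tail

/-- The branch vertex or path of the route to which a vertex or edge belongs. -/
def role [DecidableEq β] (R : K4Route β) (e : Sym2 β) : Option (Sym2 (Fin 4)) :=
  if e = s(R.branch 0, R.branch 0) then some s(0, 0) else
  if e = s(R.branch 1, R.branch 1) then some s(1, 1) else
  if e = s(R.branch 2, R.branch 2) then some s(2, 2) else
  if e = s(R.branch 3, R.branch 3) then some s(3, 3) else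
  if e ∈ R.elements 0 1 then some s(0, 1) else
  if e ∈ R.elements 0 2 then some s(0, 2) else
  if e ∈ R.elements 0 3 then some s(0, 3) else
  if e ∈ R.elements 1 2 then some s(1, 2) else
  if e ∈ R.elements 1 3 then some s(1, 3) else
  if e ∈ R.elements 2 3 then some s(2, 3) else none

/-- `e` belongs to the closed path from branch `i` to branch `j`. -/
def OnPath [DecidableEq β] (R : K4Route β) (i j : Fin 4) (e : Sym2 β) : Prop :=
  R.role e = some s(i, i) ∨ R.role e = some s(j, j) ∨ R.role e = some s(i, j)

instance [DecidableEq β] (R : K4Route β) (i j : Fin 4) (e : Sym2 β) :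
    Decidable (R.OnPath i j e) := by
  unfold OnPath
  infer_instance

/-- The route describes internally disjoint paths in `H` between distinct branch vertices. -/
def Valid [DecidableEq β] (R : K4Route β) (H : SimpleGraph β) : Prop :=
  (∀ i j, R.branch i = R.branch j → i = j) ∧
  ∀ i j, i < j → (R.path i j).IsChain fun x y =>
    H.Adj x y ∧ R.OnPath i j s(x, x) ∧ R.OnPath i j s(y, y) ∧ R.OnPath i j s(x, y)

instance [DecidableEq β] (R : K4Route β) (H : SimpleGraph β) [DecidableRel H.Adj] :
    Decidable (R.Valid H) := by
  unfold Valid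
  infer_instance

theorem connIn_of_isChain {α : Type*} {G : SimpleGraph α} {S : Set α} {φ : β → α}
    {r : β → β → Prop} (hr : ∀ x y, r x y → ConnIn G S (φ x) (φ y)) :
    ∀ (l : List β) (x y : β), (x :: (l ++ [y])).IsChain r → ConnIn G S (φ x) (φ y)
  | [], x, y, h => hr x y (by simpa using h)
  | z :: l, x, y, h => by
    rw [List.cons_append, List.isChain_cons_cons] at h
    exact (hr x z h.1).trans (connIn_of_isChain hr l z y h.2)

variable [DecidableEq β] {R : K4Route β}

theorem role_eq_diag_iff (hR : Function.Injective R.branch) (e : Sym2 β) (i : Fin 4) :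
    R.role e = some s(i, i) ↔ e = s(R.branch i, R.branch i) := by
  constructor
  · intro h
    unfold role at h
    split_ifs at h <;> simp only [Option.some.injEq] at h <;> fin_cases i <;>
      first
      | assumption
      | exact absurd h (by decide)
  · rintro rfl
    have h : ∀ j, s(R.branch i, R.branch i) = s(R.branch j, R.branch j) ↔ i = j := by
      intro j
      simp [hR.eq_iff]
    unfold role
    simp only [h]
    fin_cases i <;> rfl

/-- A valid route through `H` turns models of `H` into models of `K₄`. -/
theorem Valid.model {α : Type*} {H : SimpleGraph β} {G : SimpleGraph α}
    {c : α → Option (Sym2 β)} {φ : β → α} (hR : R.Valid H) (M : SubdivModel H G c φ) :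
    SubdivModel K4 G (fun z => (c z).bind R.role) (φ ∘ R.branch) := by
  have hlt : ∀ i j, i < j → ConnIn G (bag (fun z => (c z).bind R.role) i j)
      (φ (R.branch i)) (φ (R.branch j)) := by
    intro i j hij
    refine connIn_of_isChain (fun x y h => ?_) _ _ _ (hR.2 i j hij)
    refine (M.conn x y h.1).mono fun z hz => ?_
    rcases hz with hz | hz | hz
    · simpa [bag, hz, OnPath] using h.2.1
    · simpa [bag, hz, OnPath] using h.2.2.1
    · simpa [bag, hz, OnPath] using h.2.2.2
  refine ⟨fun x i => ?_, fun i j hij => ?_⟩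
  · rw [Option.bind_eq_some_iff]
    constructor
    · rintro ⟨e, he, he'⟩
      rw [role_eq_diag_iff hR.1] at he'
      rw [he', M.label_iff] at he
      exact he
    · rintro rfl
      exact ⟨_, M.label _, (role_eq_diag_iff hR.1 _ _).2 rfl⟩
  · rcases lt_or_gt_of_ne hij.ne with h | h
    · exact hlt i j h
    · rw [bag_comm]
      exact (hlt j i h).symm

end K4Route

section NoProper

variable {α β : Type*} [Finite α] [DecidableEq β] {H : SimpleGraph β} {G : SimpleGraph α}
  {c : α → Option (Sym2 β)} {φ : β → α} {R : K4Route β}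

/-- In a graph without proper `K₄`-subdivision, every vertex plays a role in every route. -/
theorem K4Route.Valid.role_ne_none (hR : R.Valid H) (hG : ¬ HasProperK4Subdivision G)
    (M : SubdivModel H G c φ) (z : α) : (c z).bind R.role ≠ none :=
  fun h => hG ((hR.model M).hasProperK4Subdivision (v := z) h)

theorem K4Route.Valid.exists_label (hR : R.Valid H) (hG : ¬ HasProperK4Subdivision G)
    (M : SubdivModel H G c φ) (z : α) : ∃ e, c z = some e ∧ R.role e ≠ none := by
  have := hR.role_ne_none hG M z
  cases h : c z with
  | none => simp [h] at this
  | some e => exact ⟨e, rfl, by simpa [h] using this⟩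

theorem K4Route.Valid.minimal (hR : R.Valid H) (hG : ¬ HasProperK4Subdivision G)
    (M : SubdivModel H G c φ) {a b : β} (hab : H.Adj a b) {z : α} (hz : c z = some s(a, b)) :
    ¬ ConnIn G (bag c a b \ {z}) (φ a) (φ b) := by
  classical
  intro hc
  refine hR.role_ne_none hG (M.erase hab.ne hz hc) z ?_
  simp

end NoProper

instance : DecidableRel K4.Adj := by
  unfold K4
  infer_instance

instance : DecidableRel K33.Adj := fun a b => by
  unfold K33 completeBipartiteGraph
  infer_instance

instance : DecidableRel prism.Adj := fun a b => by
  unfold prism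
  rw [boxProd_adj]
  infer_instance

/-- Adding one edge preserves decidability of adjacency. -/
instance {β : Type*} [DecidableEq β] (H : SimpleGraph β) [DecidableRel H.Adj] (a b : β) :
    DecidableRel (H ⊔ edge a b).Adj := fun x y =>
  decidable_of_iff (H.Adj x y ∨ s(a, b) = s(x, y) ∧ a ≠ b) <| by
    rw [sup_adj, adj_edge]
    refine or_congr_right (and_congr_right fun h => ?_)
    have : a = b ↔ x = y := by
      rcases Sym2.eq_iff.1 h with ⟨rfl, rfl⟩ | ⟨rfl, rfl⟩
      · rfl
      · exact eq_comm
    exact not_congr this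

/-- The route with given branch vertices in which at most two of the six paths have inner
vertices. -/
def K4Route.ofPaths {β : Type*} (v : Fin 4 → β) (p q : (Fin 4 × Fin 4) × List β) : K4Route β where
  branch := v
  inner i j := if (i, j) = p.1 then p.2 else if (i, j) = q.1 then q.2 else []

theorem K4Route.Valid.role_branch_ne_none {α β : Type*} [Finite α] [DecidableEq β]
    {H : SimpleGraph β} {G : SimpleGraph α} {c : α → Option (Sym2 β)} {φ : β → α} {R : K4Route β}
    (hR : R.Valid H) (hG : ¬ HasProperK4Subdivision G) (M : SubdivModel H G c φ) (b : β) :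
    R.role s(b, b) ≠ none := by
  simpa [M.label b] using hR.role_ne_none hG M (φ b)

theorem K4Route.Valid.role_label_ne_none {α β : Type*} [Finite α] [DecidableEq β]
    {H : SimpleGraph β} {G : SimpleGraph α} {c : α → Option (Sym2 β)} {φ : β → α} {R : K4Route β}
    (hR : R.Valid H) (hG : ¬ HasProperK4Subdivision G) (M : SubdivModel H G c φ) {z : α}
    {e : Sym2 β} (hz : c z = some e) : R.role e ≠ none := by
  simpa [hz] using hR.role_ne_none hG M z

section K33

/-- A subdivision of `K₄` in `K₃₃` avoiding the edge between `i` and `j`. -/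
def K33AvoidEdge (i j : Fin 3) : K4Route (Fin 3 ⊕ Fin 3) :=
  .ofPaths ![.inl (i + 1), .inl (i + 2), .inr (j + 1), .inr (j + 2)]
    ((0, 1), [.inr j]) ((2, 3), [.inl i])

theorem K33AvoidEdge_valid : ∀ i j, (K33AvoidEdge i j).Valid K33 := by
  decide +kernel

theorem K33AvoidEdge_role : ∀ x y : Fin 3 ⊕ Fin 3, x ≠ y →
    ∃ i j, (K33AvoidEdge i j).role s(x, y) = none := by
  decide +kernel

/-- A subdivision of `K₄` in `K₃₃` with an additional edge between two vertices of one part. -/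
def K33Chord : Fin 3 ⊕ Fin 3 → Fin 3 ⊕ Fin 3 → K4Route (Fin 3 ⊕ Fin 3)
  | .inl i, .inl j => .ofPaths ![.inl i, .inl j, .inr 0, .inr 1]
      ((2, 3), [.inl (-(i + j))]) ((2, 3), [])
  | .inr i, .inr j => .ofPaths ![.inr i, .inr j, .inl 0, .inl 1]
      ((2, 3), [.inr (-(i + j))]) ((2, 3), [])
  | _, _ => K33AvoidEdge 0 0

theorem K33Chord_valid : ∀ x y, x ≠ y → ¬ K33.Adj x y →
    (K33Chord x y).Valid (K33 ⊔ edge x y) ∧ ∃ b, (K33Chord x y).role s(b, b) = none := by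
  decide +kernel

theorem SubdivModel.isSubdivision_K33 {α : Type*} [Finite α] {G : SimpleGraph α}
    (hG : ¬ HasProperK4Subdivision G) {c : α → Option (Sym2 (Fin 3 ⊕ Fin 3))}
    {φ : Fin 3 ⊕ Fin 3 → α} (M : SubdivModel K33 G c φ) : IsSubdivision G K33 := by
  have hno : ∀ z a b, a ≠ b → c z ≠ some s(a, b) := by
    intro z a b hab hz
    obtain ⟨i, j, h⟩ := K33AvoidEdge_role a b hab
    exact (K33AvoidEdge_valid i j).role_label_ne_none hG M hz h
  have hbranch : ∀ z, ∃ b, z = φ b := by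
    intro z
    obtain ⟨e, he, -⟩ := (K33AvoidEdge_valid 0 0).exists_label hG M z
    induction e with
    | _ a b =>
    by_cases hab : a = b
    · subst hab
      exact ⟨a, (M.label_iff z a).1 he⟩
    · exact (hno z a b hab he).elim
  refine IsTight.isSubdivision (M := M) ⟨fun z => Or.inl (hbranch z), fun x y hxy => ?_,
    fun a b z hab hz => (hno z a b hab.ne hz).elim⟩
  obtain ⟨a, rfl⟩ := hbranch x
  obtain ⟨b, rfl⟩ := hbranch y
  have hab : a ≠ b := fun h => hxy.ne (h ▸ rfl)
  by_cases h : K33.Adj a b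
  · exact ⟨a, b, h, M.left_mem a b, M.right_mem a b⟩
  · obtain ⟨hv, b', hb'⟩ := K33Chord_valid a b hab h
    exact (hv.role_branch_ne_none hG (M.addEdge hxy) b' hb').elim

end K33

section Prism

/-- The matching edge `i` of the prism, subdivided. -/
abbrev splitPrism (i : Fin 3) : SimpleGraph (Option (Fin 3 × Fin 2)) :=
  splitEdge prism (i, 0) (i, 1)

/-- The matching edges `i` and `j` of the prism, subdivided. -/
abbrev splitSplitPrism (i j : Fin 3) : SimpleGraph (Option (Option (Fin 3 × Fin 2))) :=
  splitEdge (splitPrism i) (some (j, 0)) (some (j, 1))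

/-- A subdivision of `K₄` in the prism avoiding the triangle edge opposite of `(i, k)`. -/
def prismAvoidEdge (i : Fin 3) (k : Fin 2) : K4Route (Fin 3 × Fin 2) :=
  .ofPaths ![(i, k), (i, k + 1), (i + 1, k + 1), (i + 2, k + 1)]
    ((0, 2), [(i + 1, k)]) ((0, 3), [(i + 2, k)])

theorem prismAvoidEdge_valid : ∀ i k, (prismAvoidEdge i k).Valid prism := by
  decide +kernel

theorem prismAvoidEdge_role : ∀ x y : Fin 3 × Fin 2, x.1 ≠ y.1 →
    ∃ i k, (prismAvoidEdge i k).role s(x, y) = none := by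
  decide +kernel

/-- A subdivision of `K₄` in the prism with one subdivided matching edge. -/
def splitPrismRoute (i : Fin 3) : K4Route (Option (Fin 3 × Fin 2)) where
  branch := ![some (i, 0), some (i, 1), some (i + 1, 1), some (i + 2, 1)]
  inner a b := if a = 0 then ![[], [none], [some (i + 1, 0)], [some (i + 2, 0)]] b else []

theorem splitPrismRoute_valid : ∀ i, (splitPrismRoute i).Valid (splitPrism i) := by
  decide +kernel

/-- A subdivision of `K₄` in the prism with a diagonal of a square. -/
def prismBranchBranch (i j : Fin 3) (k : Fin 2) : K4Route (Fin 3 × Fin 2) :=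
  .ofPaths ![(i, k), (i, k + 1), (j, k + 1), (-(i + j), k + 1)]
    ((0, 3), [(-(i + j), k)]) ((0, 3), [])

theorem prismBranchBranch_valid : ∀ i j k, i ≠ j →
    (prismBranchBranch i j k).Valid (prism ⊔ edge (i, k) (j, k + 1)) ∧
      (prismBranchBranch i j k).role s((j, k), (j, k)) = none := by
  decide +kernel

/-- A subdivision of `K₄` in the prism with an edge between a vertex and a matching edge. -/
def prismBranchInner (i j : Fin 3) (k : Fin 2) : K4Route (Option (Fin 3 × Fin 2)) :=
  .ofPaths ![some (i, k), some (i, k + 1), some (j, k + 1), some (-(i + j), k + 1)]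
    ((0, 3), [some (-(i + j), k)]) ((0, 2), [none])

theorem prismBranchInner_valid : ∀ i j k, i ≠ j →
    (prismBranchInner i j k).Valid (splitPrism j ⊔ edge (some (i, k)) none) ∧
      (prismBranchInner i j k).role s(some (j, k), some (j, k)) = none := by
  decide +kernel

/-- A subdivision of `K₄` in the prism with an edge between two matching edges. -/
def prismInnerInner (i j : Fin 3) : K4Route (Option (Option (Fin 3 × Fin 2))) :=
  .ofPaths ![none, some (some (i, 1)), some (some (j, 1)), some (some (-(i + j), 1))]
    ((0, 3), [some (some (i, 0)), some (some (-(i + j), 0))]) ((0, 2), [some none])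

theorem prismInnerInner_valid : ∀ i j, i ≠ j →
    (prismInnerInner i j).Valid (splitSplitPrism j i ⊔ edge none (some none)) ∧
      (prismInnerInner i j).role s(some (some (j, 0)), some (some (j, 0))) = none := by
  decide +kernel

theorem SubdivModel.isSubdivision_prism {α : Type*} [Finite α] {G : SimpleGraph α}
    (hG : ¬ HasProperK4Subdivision G) {c : α → Option (Sym2 (Fin 3 × Fin 2))}
    {φ : Fin 3 × Fin 2 → α} (M : SubdivModel prism G c φ) : IsSubdivision G prism := by
  have hadj : ∀ i : Fin 3, prism.Adj (i, 0) (i, 1) := by decide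
  have hlabel : ∀ z, (∃ i k, z = φ (i, k)) ∨ ∃ i, c z = some s((i, 0), (i, 1)) := by
    intro z
    obtain ⟨e, he, -⟩ := (prismAvoidEdge_valid 0 0).exists_label hG M z
    induction e with
    | _ a b =>
    by_cases hab : a.1 = b.1
    · obtain ⟨i, k⟩ := a
      obtain ⟨j, l⟩ := b
      obtain rfl : i = j := hab
      by_cases hkl : k = l
      · subst hkl
        exact Or.inl ⟨i, k, (M.label_iff z _).1 he⟩
      · right
        refine ⟨i, he.trans ?_⟩
        revert hkl
        clear he
        revert i k l
        decide
    · obtain ⟨i, k, h⟩ := prismAvoidEdge_role a b hab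
      exact ((prismAvoidEdge_valid i k).role_label_ne_none hG M he h).elim
  have hmin : ∀ {a b z}, prism.Adj a b → c z = some s(a, b) →
      ¬ ConnIn G (bag c a b \ {z}) (φ a) (φ b) :=
    fun hab hz => (prismAvoidEdge_valid 0 0).minimal hG M hab hz
  have branch_branch : ∀ i j k l, i ≠ j → G.Adj (φ (i, k)) (φ (j, l)) → k = l := by
    intro i j k l hij h
    by_contra hkl
    obtain rfl : l = k + 1 := by
      revert hkl
      clear h
      revert k l
      decide
    obtain ⟨hv, h'⟩ := prismBranchBranch_valid i j k hij
    exact hv.role_branch_ne_none hG (M.addEdge h) _ h'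
  have branch_inner : ∀ i j k y, c y = some s((j, 0), (j, 1)) → G.Adj (φ (i, k)) y → i = j := by
    intro i j k y hy h
    by_contra hij
    obtain ⟨c', M', -⟩ := M.split (hadj j) hy (hmin (hadj j) hy)
    obtain ⟨hv, h'⟩ := prismBranchInner_valid i j k hij
    exact hv.role_branch_ne_none hG (M'.addEdge (a := some (i, k)) (b := none) h) _ h'
  have inner_inner : ∀ i j x y, c x = some s((i, 0), (i, 1)) → c y = some s((j, 0), (j, 1)) →
      G.Adj x y → i = j := by
    intro i j x y hx hy h
    by_contra hij
    obtain ⟨c', M', hc', -⟩ := M.split (hadj j) hy (hmin (hadj j) hy)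
    have hx' : c' x = some s(some (i, 0), some (i, 1)) := hc' x _ hx (by simp [hij])
    have hi : (splitPrism j).Adj (some (i, 0)) (some (i, 1)) := ⟨hadj i, by simp [hij]⟩
    obtain ⟨c'', M'', -⟩ := M'.split hi hx' ((splitPrismRoute_valid j).minimal hG M' hi hx')
    obtain ⟨hv, h'⟩ := prismInnerInner_valid i j hij
    exact hv.role_branch_ne_none hG (M''.addEdge (a := none) (b := some none) h) _ h'
  have hbag : ∀ i k, φ (i, k) ∈ bag c (i, 0) (i, 1) := by
    intro i k
    rw [M.mem_bag]
    fin_cases k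
    · exact Or.inl rfl
    · exact Or.inr (Or.inl rfl)
  refine IsTight.isSubdivision (M := M) ⟨fun z => ?_, fun x y hxy => ?_, fun a b z => hmin⟩
  · rcases hlabel z with ⟨i, k, h⟩ | ⟨i, h⟩
    · exact Or.inl ⟨_, h⟩
    · exact Or.inr ⟨_, _, hadj i, h⟩
  · rcases hlabel x with ⟨i, k, rfl⟩ | ⟨i, hx⟩ <;> rcases hlabel y with ⟨j, l, rfl⟩ | ⟨j, hy⟩
    · by_cases hij : i = j
      · subst hij
        exact ⟨_, _, hadj i, hbag i k, hbag i l⟩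
      · obtain rfl := branch_branch i j k l hij hxy
        refine ⟨(i, k), (j, k), ?_, M.left_mem _ _, M.right_mem _ _⟩
        rw [prism, boxProd_adj]
        exact Or.inl ⟨hij, rfl⟩
    · obtain rfl := branch_inner i j k y hy hxy
      exact ⟨_, _, hadj i, hbag i k, Or.inr (Or.inr hy)⟩
    · obtain rfl := branch_inner j i l x hx hxy.symm
      exact ⟨_, _, hadj j, Or.inr (Or.inr hx), hbag j l⟩
    · obtain rfl := inner_inner i j x y hx hy hxy
      exact ⟨_, _, hadj i, Or.inr (Or.inr hx), Or.inr (Or.inr hy)⟩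

end Prism

/-- The subdivision of `K₄` in `K₄` itself. -/
def K4Trivial : K4Route (Fin 4) := .ofPaths id ((0, 1), []) ((0, 1), [])

theorem K4Trivial_valid : K4Trivial.Valid K4 := by
  decide +kernel

/-- The subdivision of `K₄` in `K₄` with the edge `ab` subdivided. -/
def splitK4Route (a b : Fin 4) : K4Route (Option (Fin 4)) :=
  .ofPaths some ((a, b), [none]) ((b, a), [none])

theorem splitK4Route_valid : ∀ a b, a ≠ b →
    (splitK4Route a b).Valid (splitEdge K4 a b) := by
  decide +kernel

/-- `K₄` with two disjoint edges subdivided and the new vertices joined is `K₃₃`. -/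
def toK33 : Option (Option (Fin 4)) ≃ Fin 3 ⊕ Fin 3 where
  toFun o := o.elim (.inl 0) fun o => o.elim (.inr 0) ![.inl 1, .inl 2, .inr 1, .inr 2]
  invFun := Sum.elim ![none, some (some 0), some (some 1)]
    ![some none, some (some 2), some (some 3)]
  left_inv := by decide
  right_inv := by decide

theorem toK33_adj : ∀ a b, K33.Adj (toK33 a) (toK33 b) →
    (splitEdge (splitEdge K4 0 1) (some 2) (some 3) ⊔ edge none (some none)).Adj a b := by
  decide +kernel

/-- `K₄` with two incident edges subdivided and the new vertices joined is the prism. -/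
def toPrism : Option (Option (Fin 4)) ≃ Fin 3 × Fin 2 where
  toFun o := o.elim (2, 0) fun o => o.elim (1, 0) ![(0, 0), (1, 1), (2, 1), (0, 1)]
  invFun p := ![![some (some 0), some (some 3)], ![some none, some (some 1)],
    ![none, some (some 2)]] p.1 p.2
  left_inv := by decide
  right_inv := by decide

theorem toPrism_adj : ∀ a b, prism.Adj (toPrism a) (toPrism b) →
    (splitEdge (splitEdge K4 0 1) (some 0) (some 2) ⊔ edge none (some none)).Adj a b := by
  decide +kernel

/-- The branch vertices of a model of `K₄` can be permuted. -/
theorem SubdivModel.permute {α : Type*} {G : SimpleGraph α} {c : α → Option (Sym2 (Fin 4))}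
    {φ : Fin 4 → α} (M : SubdivModel K4 G c φ) {f : Fin 4 → Fin 4}
    (hf : Function.Injective f) : ∃ c', SubdivModel K4 G c' (φ ∘ f) ∧
      ∀ z i j, c' z = some s(i, j) ↔ c z = some s(f i, f j) := by
  let e : Fin 4 ≃ Fin 4 := Equiv.ofBijective f (Finite.injective_iff_bijective.1 hf)
  refine ⟨_, M.transport (H' := K4) e.symm fun a b h h' => h (h' ▸ rfl), fun z i j => ?_⟩
  have : s(i, j) = (s(f i, f j)).map e.symm := by
    simp [show ∀ i, e.symm (f i) = i from e.symm_apply_apply]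
  rw [this, Option.map_eq_some_iff]
  refine ⟨fun ⟨l, hl, hl'⟩ => ?_, fun h => ⟨_, h, rfl⟩⟩
  rw [hl, Sym2.map.injective e.symm.injective hl']

section

variable {α : Type*} [Finite α] {G : SimpleGraph α} {c : α → Option (Sym2 (Fin 4))}
  {φ : Fin 4 → α}

theorem SubdivModel.split_K4 (hG : ¬ HasProperK4Subdivision G) (M : SubdivModel K4 G c φ)
    {a b : Fin 4} (hab : a ≠ b) {x : α} (hx : c x = some s(a, b)) :
    ∃ c', SubdivModel (splitEdge K4 a b) G c' (fun o => o.elim x φ) ∧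
      (∀ z e, c z = some e → e ≠ s(a, b) → c' z = some (e.map some)) ∧
      ∀ z, c z = some s(a, b) → z ≠ x →
        c' z = some s(none, some a) ∨ c' z = some s(none, some b) :=
  M.split hab hx (K4Trivial_valid.minimal hG M hab hx)

theorem SubdivModel.split_splitK4 (hG : ¬ HasProperK4Subdivision G) {a b : Fin 4} (hab : a ≠ b)
    {c : α → Option (Sym2 (Option (Fin 4)))} {φ : Option (Fin 4) → α}
    (M : SubdivModel (splitEdge K4 a b) G c φ) {s t : Option (Fin 4)}
    (hst : (splitEdge K4 a b).Adj s t) {x : α} (hx : c x = some s(s, t)) :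
    ∃ c', SubdivModel (splitEdge (splitEdge K4 a b) s t) G c' (fun o => o.elim x φ) := by
  obtain ⟨c', M', -⟩ := M.split hst hx ((splitK4Route_valid a b hab).minimal hG M hst hx)
  exact ⟨c', M'⟩

theorem SubdivModel.isSubdivision_K33_of_disjoint (hG : ¬ HasProperK4Subdivision G)
    (M : SubdivModel K4 G c φ) {i j k l : Fin 4} (hf : Function.Injective ![i, j, k, l])
    {x y : α} (hx : c x = some s(i, j)) (hy : c y = some s(k, l)) (hxy : G.Adj x y) :
    IsSubdivision G K33 := by
  obtain ⟨c', M', h⟩ := M.permute hf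
  obtain ⟨c₁, M₁, h₁, -⟩ := M'.split_K4 hG (a := 0) (b := 1) (by decide) ((h x 0 1).2 hx)
  obtain ⟨c₂, M₂⟩ := M₁.split_splitK4 hG (by decide) (s := some 2) (t := some 3) (by decide)
    (h₁ y s(2, 3) ((h y 2 3).2 hy) (by decide))
  exact ((M₂.addEdge (a := none) (b := some none) hxy.symm).transport toK33
    toK33_adj).isSubdivision_K33 hG

theorem SubdivModel.isSubdivision_prism_of_incident (hG : ¬ HasProperK4Subdivision G)
    (M : SubdivModel K4 G c φ) {i j k l : Fin 4} (hf : Function.Injective ![i, j, k, l])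
    {x y : α} (hx : c x = some s(i, j)) (hy : c y = some s(i, k)) (hxy : G.Adj x y) :
    IsSubdivision G prism := by
  obtain ⟨c', M', h⟩ := M.permute hf
  obtain ⟨c₁, M₁, h₁, -⟩ := M'.split_K4 hG (a := 0) (b := 1) (by decide) ((h x 0 1).2 hx)
  obtain ⟨c₂, M₂⟩ := M₁.split_splitK4 hG (by decide) (s := some 0) (t := some 2) (by decide)
    (h₁ y s(0, 2) ((h y 0 2).2 hy) (by decide))
  exact ((M₂.addEdge (a := none) (b := some none) hxy.symm).transport toPrism
    toPrism_adj).isSubdivision_prism hG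

/-- `K₄` together with a vertex on the edge `12` joined to `0` contains a subdivision of `K₄`
avoiding the edge `0m`. -/
def avoidSpoke : Fin 4 → K4Route (Option (Fin 4)) :=
  ![.ofPaths ![some 0, some 1, some 2, some 3] ((1, 2), [none]) ((1, 2), [none]),
    .ofPaths ![some 0, none, some 2, some 3] ((1, 3), [some 1]) ((1, 3), [some 1]),
    .ofPaths ![some 0, none, some 1, some 3] ((1, 3), [some 2]) ((1, 3), [some 2]),
    .ofPaths ![some 0, none, some 1, some 2] ((2, 3), [some 3]) ((2, 3), [some 3])]

theorem avoidSpoke_valid : ∀ m, (avoidSpoke m).Valid (splitEdge K4 1 2 ⊔ edge (some 0) none) ∧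
    (m ≠ 0 → (avoidSpoke m).role s(some 0, some m) = none) := by
  decide +kernel

/-- If the branch vertex `i` has a neighbour on a path not ending in `i`, then the paths ending
in `i` have no inner vertices. -/
theorem SubdivModel.spoke_plain (hG : ¬ HasProperK4Subdivision G) (M : SubdivModel K4 G c φ)
    {i j k : Fin 4} (hij : i ≠ j) (hik : i ≠ k) (hjk : j ≠ k) {y : α} (hy : c y = some s(j, k))
    (hadj : G.Adj (φ i) y) (m : Fin 4) (hm : i ≠ m) (z : α) : c z ≠ some s(i, m) := by
  intro hz
  obtain ⟨l, hl⟩ : ∃ l, Function.Injective ![i, j, k, l] := by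
    clear hy hadj hm hz
    revert i j k
    decide
  obtain ⟨c', M', h⟩ := M.permute hl
  obtain ⟨n, rfl⟩ : ∃ n, ![i, j, k, l] n = m := (Finite.injective_iff_surjective.1 hl) m
  obtain ⟨c₁, M₁, h₁, -⟩ := M'.split_K4 hG (a := 1) (b := 2) (by decide) ((h y 1 2).2 hy)
  obtain ⟨hv, h'⟩ := avoidSpoke_valid n
  have hn : n ≠ 0 := by
    rintro rfl
    exact hm rfl
  refine hv.role_label_ne_none hG (M₁.addEdge (a := some 0) (b := none) hadj)
    (h₁ z s(0, n) ((h z 0 n).2 hz) ?_) (h' hn)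
  simp

/-- Two chords of a path from `1` to `2` to the other branch vertices yield a `K₄`. -/
def twoHubs : K4Route (Option (Fin 4)) :=
  .ofPaths ![some 0, some 3, some 1, none] ((0, 1), []) ((0, 1), [])

theorem twoHubs_valid :
    twoHubs.Valid (splitEdge K4 1 2 ⊔ edge (some 0) none ⊔ edge (some 3) none) ∧
      twoHubs.role s(some 2, some 2) = none := by
  decide +kernel

/-- As `twoHubs`, with the chords ending in different vertices, where `m` is the branch vertex on
the far side. -/
def twoHubsApart (m : Fin 4) : K4Route (Option (Option (Fin 4))) :=
  .ofPaths ![some (some 0), some (some 3), some (some m), some none] ((1, 3), [none])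
    ((1, 3), [none])

set_option synthInstance.maxSize 1000 in
theorem twoHubsApart_valid : ∀ m n : Fin 4, s(m, n) = s(1, 2) →
    (twoHubsApart m).Valid (splitEdge (splitEdge K4 1 2) none (some n) ⊔
      edge (some (some 0)) (some none) ⊔ edge (some (some 3)) none) ∧
      (twoHubsApart m).role s(some (some n), some (some n)) = none := by
  decide +kernel

/-- At most one branch vertex has a neighbour on a path not ending in it. -/
theorem SubdivModel.hub_unique (hG : ¬ HasProperK4Subdivision G) (M : SubdivModel K4 G c φ)
    {y z : α} (hy : c y = some s(1, 2)) (hz : c z = some s(1, 2)) (h0 : G.Adj (φ 0) y) :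
    ¬ G.Adj (φ 3) z := by
  intro h3
  obtain ⟨c₁, M₁, -, h₁⟩ := M.split_K4 hG (a := 1) (b := 2) (by decide) hy
  by_cases hzy : z = y
  · subst hzy
    exact twoHubs_valid.1.role_branch_ne_none hG ((M₁.addEdge (a := some 0) (b := none) h0).addEdge
      (a := some 3) (b := none) h3) _ twoHubs_valid.2
  · have key : ∀ m n : Fin 4, s(m, n) = s(1, 2) → (splitEdge K4 1 2).Adj none (some n) →
        c₁ z ≠ some s(none, some n) := by
      intro m n hmn hn hz'
      obtain ⟨c₂, M₂⟩ := M₁.split_splitK4 hG (by decide) hn hz'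
      obtain ⟨hv, h'⟩ := twoHubsApart_valid m n hmn
      exact hv.role_branch_ne_none hG ((M₂.addEdge (a := some (some 0)) (b := some none) h0).addEdge
        (a := some (some 3)) (b := none) h3) _ h'
    rcases h₁ z hz hzy with h | h
    · exact key 2 1 (by decide) (by decide) h
    · exact key 1 2 (by decide) (by decide) h

end

theorem isWheel_of_iso {α : Type*} {G : SimpleGraph α} {v w : α} (hvw : G.Adj v w) {n : ℕ}
    (hn : 3 ≤ n) (f : G.induce {u | u ≠ v} ≃g cycleGraph n) : ∃ k, 0 < k ∧ IsWheel k G := by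
  classical
  let T : Finset (Fin n) := Finset.univ.filter fun i => G.Adj v (f.symm i).1
  have hT : ∀ i, i ∈ T ↔ G.Adj v (f.symm i).1 := by simp [T]
  let g : Fin n ⊕ Unit → α := Sum.elim (fun i => (f.symm i).1) fun _ => v
  have hg : Function.Bijective g := by
    constructor
    · rintro (i | _) (j | _) h
      · exact congrArg Sum.inl (f.symm.injective (Subtype.ext h))
      · exact ((f.symm i).2 h).elim
      · exact ((f.symm j).2 h.symm).elim
      · rfl
    · intro x
      by_cases hx : x = v
      · exact ⟨Sum.inr (), hx.symm⟩
      · exact ⟨Sum.inl (f ⟨x, hx⟩), by simp [g]⟩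
  have hadj : ∀ i j, G.Adj (f.symm i).1 (f.symm j).1 ↔ (cycleGraph n).Adj i j := by
    intro i j
    rw [← f.symm.map_adj_iff]
    rfl
  have e : wheelGraph n T ≃g G := by
    refine ⟨Equiv.ofBijective g hg, fun {a b} => ?_⟩
    rw [wheelGraph, fromRel_adj]
    rcases a with i | _ <;> rcases b with j | _
    · simp only [Equiv.ofBijective_apply, g, Sum.elim_inl, hadj]
      simp only [Sum.inl.injEq, ne_eq, reduceCtorEq, false_and, and_false, exists_false, or_false]
      constructor
      · intro h
        exact ⟨h.ne, Or.inl ⟨i, j, rfl, rfl, h⟩⟩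
      · rintro ⟨-, ⟨x, y, rfl, rfl, h⟩ | ⟨x, y, rfl, rfl, h⟩⟩
        · exact h
        · exact h.symm
    · simp [g, hT, G.adj_comm]
    · simp [g, hT]
    · simp [g]
  refine ⟨T.card, Finset.card_pos.2 ⟨f ⟨w, hvw.ne'⟩, (hT _).2 ?_⟩, n, hn, ?_, T, rfl, ⟨e.symm⟩⟩
  · simpa using hvw
  · simpa using T.card_le_univ

theorem cycleGraph_adj_val {n : ℕ} (hn : 3 ≤ n) (a b : Fin n) :
    (cycleGraph n).Adj a b ↔ a.val + 1 = b.val ∨ b.val + 1 = a.val ∨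
      (a.val = 0 ∧ b.val + 1 = n) ∨ (b.val = 0 ∧ a.val + 1 = n) := by
  rw [cycleGraph_adj', Fin.val_sub, Fin.val_sub]
  have key : ∀ x y : ℕ, x < n → y < n →
      ((n - y + x) % n = 1 ↔ y + 1 = x ∨ (x = 0 ∧ y + 1 = n)) := by
    intro x y hx hy
    by_cases h : y ≤ x
    · rw [show n - y + x = (x - y) + n by omega, Nat.add_mod_right, Nat.mod_eq_of_lt (by omega)]
      omega
    · rw [Nat.mod_eq_of_lt (by omega)]
      omega
  rw [key _ _ a.2 b.2, key _ _ b.2 a.2]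
  omega

/-- The edge between `u` and `v` in a cycle can be moved to the closing edge. -/
theorem exists_cycleGraph_iso {n : ℕ} (hn : 3 ≤ n) {u v : Fin n} (h : (cycleGraph n).Adj u v) :
    ∃ f : cycleGraph n ≃g cycleGraph n, (f u).val + 1 = n ∧ (f v).val = 0 := by
  obtain ⟨n, rfl⟩ : ∃ m, n = m + 3 := ⟨n - 3, by omega⟩
  have hlast : (-1 : Fin (n + 3)).val + 1 = n + 3 := by
    rw [Fin.coe_neg_one]
  rw [cycleGraph_adj] at h
  rcases h with h | h
  · refine ⟨⟨Equiv.subLeft v, fun {a b} => ?_⟩, ?_, ?_⟩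
    · simp [cycleGraph_adj, or_comm]
    · change (v - u).val + 1 = _
      rw [← neg_sub, h, hlast]
    · change (v - v).val = _
      simp
  · refine ⟨⟨Equiv.subRight v, fun {a b} => ?_⟩, ?_, ?_⟩
    · simp [cycleGraph_adj]
    · change (u - v).val + 1 = _
      rw [← neg_sub, h, hlast]
    · change (v - v).val = _
      simp

theorem subdivideEdge_iso_cycleGraph {m n : ℕ} (hn : 3 ≤ n) {G : SimpleGraph (Fin m)}
    (f : G ≃g cycleGraph n) {u v : Fin m} (h : G.Adj u v) :
    Nonempty (subdivideEdge G u v ≃g cycleGraph (n + 1)) := by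
  obtain ⟨g, hgu, hgv⟩ := exists_cycleGraph_iso hn (f.map_adj_iff.2 h)
  obtain ⟨f, hfu, hfv⟩ : ∃ f : G ≃g cycleGraph n, (f u).val + 1 = n ∧ (f v).val = 0 :=
    ⟨f.trans g, hgu, hgv⟩
  obtain rfl : m = n := by simpa using Fintype.card_congr f.toEquiv
  have hu : ∀ x, x = u ↔ (f x).val + 1 = m := by
    intro x
    rw [← f.injective.eq_iff, Fin.ext_iff]
    omega
  have hv : ∀ x, x = v ↔ (f x).val = 0 := by
    intro x
    rw [← f.injective.eq_iff, Fin.ext_iff, hfv]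
  have hadj : ∀ x y, G.Adj x y ↔ _ := fun x y =>
    f.map_adj_iff.symm.trans (cycleGraph_adj_val hn (f x) (f y))
  let F : Fin (m + 1) → Fin (m + 1) := Fin.lastCases (Fin.last m) fun x => (f x).castSucc
  have hFl : F (Fin.last m) = Fin.last m := Fin.lastCases_last
  have hFc : ∀ x : Fin m, F x.castSucc = (f x).castSucc := fun x => Fin.lastCases_castSucc x
  have hF : Function.Bijective F := by
    rw [← Finite.injective_iff_bijective]
    intro a b
    cases a using Fin.lastCases <;> cases b using Fin.lastCases <;>
      simp [hFl, hFc, f.injective.eq_iff, (Fin.castSucc_ne_last _).symm]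
  refine ⟨⟨Equiv.ofBijective F hF, fun {a b} => ?_⟩⟩
  rw [Equiv.ofBijective_apply, Equiv.ofBijective_apply, cycleGraph_adj_val (by omega),
    IMWQO.subdivideEdge, fromRel_adj]
  cases a using Fin.lastCases with
  | last =>
    cases b using Fin.lastCases with
    | last => simp [hFl]; omega
    | cast b =>
      have := (f b).2
      simp [hFl, hFc, (Fin.castSucc_ne_last _).symm, hu, hv]
      omega
  | cast a =>
    have := (f a).2
    cases b using Fin.lastCases with
    | last =>
      simp [hFl, hFc, (Fin.castSucc_ne_last _).symm, hu, hv]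
      omega
    | cast b =>
      have := (f b).2
      have hab : a = b ↔ (f a).val = (f b).val := by rw [← Fin.ext_iff, f.injective.eq_iff]
      simp [hFc, hu, hv, hab, hadj]
      omega

theorem IsSubdivision.iso_cycleGraph {α : Type*} {G : SimpleGraph α}
    (h : IsSubdivision G (⊤ : SimpleGraph (Fin 3))) :
    ∃ n, 3 ≤ n ∧ Nonempty (G ≃g cycleGraph n) := by
  obtain ⟨A, B, ⟨e⟩, ⟨e'⟩, hAB⟩ := h
  suffices ∃ n, 3 ≤ n ∧ Nonempty (A.2 ≃g cycleGraph n) by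
    obtain ⟨n, hn, ⟨f⟩⟩ := this
    exact ⟨n, hn, ⟨e.trans f⟩⟩
  clear e
  induction hAB using Relation.ReflTransGen.head_induction_on with
  | refl => exact ⟨3, le_rfl, ⟨by rw [cycleGraph_three_eq_top]; exact e'.symm⟩⟩
  | head hst _ ih =>
    obtain ⟨G, u, v, huv⟩ := hst
    obtain ⟨n, hn, ⟨f⟩⟩ := ih
    exact ⟨n + 1, by omega, subdivideEdge_iso_cycleGraph hn f huv⟩

section

variable {α : Type*} [Finite α] {G : SimpleGraph α} {c : α → Option (Sym2 (Fin 4))}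
  {φ : Fin 4 → α}

/-- An edge of `G` that does not belong to a path of a `K₄`-model either yields a subdivision of
`K₃₃` or of the prism, or it joins a branch vertex to an opposite path. -/
theorem SubdivModel.adj_cases (hG : ¬ HasProperK4Subdivision G) (M : SubdivModel K4 G c φ)
    {x y : α} (hxy : G.Adj x y) :
    (∃ a b, K4.Adj a b ∧ x ∈ bag c a b ∧ y ∈ bag c a b) ∨
    (∃ i j k, i ≠ j ∧ i ≠ k ∧ j ≠ k ∧
      (x = φ i ∧ c y = some s(j, k) ∨ y = φ i ∧ c x = some s(j, k))) ∨
    IsSubdivision G K33 ∨ IsSubdivision G prism := by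
  have branch_inner : ∀ {i j k y}, j ≠ k → c y = some s(j, k) →
      (∃ a b, K4.Adj a b ∧ φ i ∈ bag c a b ∧ y ∈ bag c a b) ∨ i ≠ j ∧ i ≠ k := by
    intro i j k y hjk hy
    by_cases h : i ≠ j ∧ i ≠ k
    · exact Or.inr h
    · refine Or.inl ⟨j, k, hjk, ?_, Or.inr (Or.inr hy)⟩
      rw [M.mem_bag]
      by_cases hij : i = j
      · exact Or.inl (hij ▸ rfl)
      · exact Or.inr (Or.inl (by rw [not_and_not_right.1 h hij]))
  obtain ⟨e, hx, -⟩ := K4Trivial_valid.exists_label hG M x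
  obtain ⟨e', hy, -⟩ := K4Trivial_valid.exists_label hG M y
  induction e with | _ i j
  induction e' with | _ k l
  by_cases hij : i = j <;> by_cases hkl : k = l
  · subst hij hkl
    rw [M.label_iff] at hx hy
    subst hx hy
    exact Or.inl ⟨i, k, fun h => hxy.ne (h ▸ rfl), M.left_mem _ _, M.right_mem _ _⟩
  · subst hij
    rw [M.label_iff] at hx
    subst hx
    exact (branch_inner hkl hy).imp_right fun h =>
      Or.inl ⟨i, k, l, h.1, h.2, hkl, Or.inl ⟨rfl, hy⟩⟩
  · subst hkl
    rw [M.label_iff] at hy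
    subst hy
    exact (branch_inner hij hx).imp (fun ⟨a, b, hab, h, h'⟩ => ⟨a, b, hab, h', h⟩) fun h =>
      Or.inl ⟨k, i, j, h.1, h.2, hij, Or.inr ⟨rfl, hx⟩⟩
  · by_cases heq : s(i, j) = s(k, l)
    · exact Or.inl ⟨i, j, hij, Or.inr (Or.inr hx), Or.inr (Or.inr (heq ▸ hy))⟩
    · have fourth : ∀ a b d : Fin 4, a ≠ b → a ≠ d → b ≠ d →
          ∃ l, Function.Injective ![a, b, d, l] := by decide
      have incident : ∀ {a b d : Fin 4}, a ≠ b → a ≠ d → b ≠ d → c x = some s(a, b) →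
          c y = some s(a, d) → IsSubdivision G prism := by
        intro a b d h₁ h₂ h₃ hx hy
        obtain ⟨l, hl⟩ := fourth a b d h₁ h₂ h₃
        exact M.isSubdivision_prism_of_incident hG hl hx hy hxy
      right; right
      rw [Sym2.eq_iff] at heq
      by_cases hik : i = k
      · subst hik
        exact Or.inr (incident hij hkl (by tauto) hx hy)
      by_cases hil : i = l
      · subst hil
        exact Or.inr (incident hij (Ne.symm hkl) (by tauto) hx (Sym2.eq_swap ▸ hy))
      by_cases hjk : j = k
      · subst hjk
        exact Or.inr (incident (Ne.symm hij) hkl hil (Sym2.eq_swap ▸ hx) hy)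
      by_cases hjl : j = l
      · subst hjl
        exact Or.inr (incident (Ne.symm hij) (Ne.symm hkl) hik (Sym2.eq_swap ▸ hx)
          (Sym2.eq_swap ▸ hy))
      left
      refine M.isSubdivision_K33_of_disjoint hG (i := i) (j := j) (k := k) (l := l) ?_ hx hy hxy
      intro p q hpq
      fin_cases p <;> fin_cases q <;> first | rfl | (simp at hpq; grind)

/-- If the paths at the branch vertex `0` are edges and all edges of `G` avoiding this vertex lie on
the other paths, then deleting this vertex leaves a cycle. -/
theorem SubdivModel.isSubdivision_triangle (hG : ¬ HasProperK4Subdivision G)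
    (M : SubdivModel K4 G c φ) (hplain : ∀ z m, m ≠ 0 → c z ≠ some s(0, m))
    (hadj : ∀ x y, G.Adj x y → x ≠ φ 0 → y ≠ φ 0 →
      ∃ a b, K4.Adj a b ∧ x ∈ bag c a b ∧ y ∈ bag c a b) :
    IsSubdivision (G.induce {u | u ≠ φ 0}) (⊤ : SimpleGraph (Fin 3)) := by
  let g : Fin 4 → Fin 3 := Fin.cases 0 fun i => i
  let c' : {u | u ≠ φ 0} → Option (Sym2 (Fin 3)) := fun x => (c x).map (Sym2.map g)
  let φ' : Fin 3 → {u | u ≠ φ 0} := fun i => ⟨φ i.succ, fun h => i.succ_ne_zero (M.injective h)⟩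
  have hsucc : ∀ x : {u | u ≠ φ 0}, ∃ i j : Fin 3, c x = some s(i.succ, j.succ) := by
    rintro ⟨x, hx⟩
    obtain ⟨e, he, -⟩ := K4Trivial_valid.exists_label hG M x
    induction e with | _ a b
    have key : ∀ a b, c x = some s(a, b) → a ≠ 0 := by
      rintro a b h rfl
      by_cases hb : b = 0
      · subst hb
        exact hx ((M.label_iff x 0).1 h)
      · exact hplain x b hb h
    obtain ⟨i, rfl⟩ := Fin.exists_succ_eq.2 (key a b he)
    obtain ⟨j, rfl⟩ := Fin.exists_succ_eq.2 (key b _ (Sym2.eq_swap ▸ he))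
    exact ⟨i, j, he⟩
  have hc' : ∀ (x : {u | u ≠ φ 0}) (i j : Fin 3),
      c' x = some s(i, j) ↔ c x = some s(i.succ, j.succ) := by
    intro x i j
    obtain ⟨k, l, h⟩ := hsucc x
    simp [c', h, g]
  have hbag : ∀ i j, Subtype.val ⁻¹' bag c i.succ j.succ = bag c' i j := by
    intro i j
    ext x
    simp only [bag, hc', Set.mem_preimage, Set.mem_ofPred_eq]
    rfl
  have M' : SubdivModel (⊤ : SimpleGraph (Fin 3)) (G.induce {u | u ≠ φ 0}) c' φ' := by
    refine ⟨fun x i => ?_, fun i j hij => ?_⟩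
    · rw [hc', M.label_iff, Subtype.ext_iff]
    · rw [← hbag]
      refine (M.conn i.succ j.succ fun h => hij (Fin.succ_injective _ h)).subtype
        (P := fun u => u ≠ φ 0) (G' := G.induce {u | u ≠ φ 0}) ?_ (fun _ _ _ _ h => h) _ _
      rintro x hx rfl
      simp [bag, M.label, (Fin.succ_ne_zero _).symm] at hx
  refine IsTight.isSubdivision (M := M') ⟨fun z => ?_, fun x y hxy => ?_, fun i j z hij hz hc => ?_⟩
  · obtain ⟨i, j, h⟩ := hsucc z
    by_cases hij : i = j
    · subst hij
      exact Or.inl ⟨i, Subtype.ext ((M.label_iff _ _).1 h)⟩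
    · exact Or.inr ⟨i, j, hij, (hc' z i j).2 h⟩
  · have key : ∀ (z : {u | u ≠ φ 0}) b, b ≠ 0 → z.1 ∈ bag c 0 b → z.1 = φ b := by
      intro z b hb h
      rcases M.mem_bag.1 h with h | h | h
      · exact (z.2 h).elim
      · exact h
      · exact (hplain z b hb h).elim
    obtain ⟨a, b, hab, hx, hy⟩ := hadj x y hxy x.2 y.2
    have ha : a ≠ 0 := by
      rintro rfl
      exact G.ne_of_adj hxy ((key x b (Ne.symm hab) hx).trans (key y b (Ne.symm hab) hy).symm)
    have hb : b ≠ 0 := by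
      rintro rfl
      rw [bag_comm] at hx hy
      exact G.ne_of_adj hxy ((key x a ha hx).trans (key y a ha hy).symm)
    obtain ⟨i, rfl⟩ := Fin.exists_succ_eq.2 ha
    obtain ⟨j, rfl⟩ := Fin.exists_succ_eq.2 hb
    refine ⟨i, j, fun h => hab (h ▸ rfl), ?_, ?_⟩ <;> rw [← hbag] <;> assumption
  · refine K4Trivial_valid.minimal hG M (a := i.succ) (b := j.succ)
      (fun h => hij (Fin.succ_injective _ h)) ((hc' z i j).1 hz) ?_
    rw [← hbag] at hc
    refine hc.lift (G := G.induce {u | u ≠ φ 0}) Subtype.val fun x y hxy hx hy =>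
      .of_adj hxy ?_ ?_
    · exact ⟨hx.1, fun h => hx.2 (Subtype.ext h)⟩
    · exact ⟨hy.1, fun h => hy.2 (Subtype.ext h)⟩

/-- If a branch vertex has a neighbour on an opposite path, then `G` is a wheel unless it is a
subdivision of `K₃₃` or of the prism. -/
theorem SubdivModel.isWheel (hG : ¬ HasProperK4Subdivision G) (hK33 : ¬ IsSubdivision G K33)
    (hprism : ¬ IsSubdivision G prism) (M : SubdivModel K4 G c φ) {y : α}
    (hy : c y = some s(1, 2)) (h0 : G.Adj (φ 0) y) : ∃ k, 0 < k ∧ IsWheel k G := by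
  have hplain : ∀ z m, m ≠ 0 → c z ≠ some s(0, m) := fun z m hm =>
    M.spoke_plain hG (by decide) (by decide) (by decide) hy h0 m hm.symm z
  have hopp : ∀ {i j k x}, i ≠ 0 → i ≠ j → i ≠ k → j ≠ k → c x = some s(j, k) →
      ¬ G.Adj (φ i) x := by
    intro i j k x hi hij hik hjk hx h
    have hi3 : i = 3 := by
      have h₁ : i ≠ 1 := by
        rintro rfl
        exact M.spoke_plain hG hij hik hjk hx h 2 (by decide) y hy
      have h₂ : i ≠ 2 := by
        rintro rfl
        exact M.spoke_plain hG hij hik hjk hx h 1 (by decide) y (Sym2.eq_swap ▸ hy)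
      omega
    subst hi3
    have hj : j ≠ 0 := by
      rintro rfl
      exact hplain x k hjk.symm hx
    have hk : k ≠ 0 := by
      rintro rfl
      exact hplain x j hjk (Sym2.eq_swap ▸ hx)
    have hjk' : s(j, k) = s(1, 2) := by
      clear hx
      revert j k
      decide
    exact M.hub_unique hG hy (hjk' ▸ hx) h0 h
  obtain ⟨n, hn, ⟨f⟩⟩ := (M.isSubdivision_triangle hG hplain fun x z hxz hx hz => by
    rcases M.adj_cases hG hxz with h | ⟨i, j, k, hij, hik, hjk, ⟨rfl, h⟩ | ⟨rfl, h⟩⟩ | h | h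
    · exact h
    · exact (hopp (fun h => hx (h ▸ rfl)) hij hik hjk h hxz).elim
    · exact (hopp (fun h => hz (h ▸ rfl)) hij hik hjk h hxz.symm).elim
    · exact (hK33 h).elim
    · exact (hprism h).elim).iso_cycleGraph
  exact isWheel_of_iso h0 hn f

end

/-- A graph containing a `K₄`-subdivision either has a proper `K₄`-subdivision, or is
a wheel, or is a subdivision of `K₄`, `K_{3,3}`, or the prism. -/
theorem K4_subdivision_classification {α : Type*} [Fintype α] (G : SimpleGraph α)
    (h : ContainsSubdivAsSubgraph G K4) :
    HasProperK4Subdivision G ∨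
    (∃ k : ℕ, 0 < k ∧ IsWheel k G) ∨
    IsSubdivision G K4 ∨ IsSubdivision G K33 ∨ IsSubdivision G prism := by
  by_cases hG : HasProperK4Subdivision G
  · exact Or.inl hG
  by_cases hK33 : IsSubdivision G K33
  · tauto
  by_cases hprism : IsSubdivision G prism
  · tauto
  right
  obtain ⟨c, φ, M⟩ := h.exists_model
  by_cases hadj : ∀ x y, G.Adj x y → ∃ a b, K4.Adj a b ∧ x ∈ bag c a b ∧ y ∈ bag c a b
  · refine Or.inr (Or.inl (SubdivModel.IsTight.isSubdivision (M := M)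
      ⟨fun z => ?_, hadj, fun a b z hab hz => K4Trivial_valid.minimal hG M hab hz⟩))
    obtain ⟨e, he, -⟩ := K4Trivial_valid.exists_label hG M z
    induction e with | _ a b
    by_cases hab : a = b
    · subst hab
      exact Or.inl ⟨a, (M.label_iff _ _).1 he⟩
    · exact Or.inr ⟨a, b, hab, he⟩
  · left
    have hub : ∀ {i j k y}, i ≠ j → i ≠ k → j ≠ k → c y = some s(j, k) → G.Adj (φ i) y →
        ∃ k, 0 < k ∧ IsWheel k G := by
      intro i j k y hij hik hjk hy h
      obtain ⟨l, hl⟩ : ∃ l, Function.Injective ![i, j, k, l] := by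
        clear hy h
        revert i j k
        decide
      obtain ⟨c', M', h'⟩ := M.permute hl
      exact M'.isWheel hG hK33 hprism ((h' y 1 2).2 hy) h
    push Not at hadj
    obtain ⟨x, y, hxy, hno⟩ := hadj
    rcases M.adj_cases hG hxy with ⟨a, b, hab, hx, hy⟩ |
      ⟨i, j, k, hij, hik, hjk, ⟨rfl, h⟩ | ⟨rfl, h⟩⟩ | h | h
    · exact (hno a b hab hx hy).elim
    · exact hub hij hik hjk h hxy
    · exact hub hij hik hjk h hxy.symm
    · exact (hK33 h).elim
    · exact (hprism h).elim

end IMWQO
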